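/- arXiv:2012.11115 — 2 statements merged into one kernel-verified Lean document; each statement's English description precedes it below -/
import Mathlib

section
/- Let T = (T_1, …, T_d) be a commuting d-tuple of bounded operators on a complex separable Hilbert space H belonging to the class BS_{m,θ}, i.e. T is m-polynomially cyclic and, with P_N the orthogonal projection onto H_N: (i) P_N T_j P_N^⊥ = 0 for all j and N; (ii) dEt([[T*, T]]) is non-negative definite; (iii) for every τ ∈ S_d and every N, ‖P_N (Σ_{η ∈ S_d} sgn(η) T*_{η(1)} T_{τ(1)} T*_{η(2)} ··· T*_{η(d)}) P_N^⊥ T_{τ(d)} P_N‖ ≤ θ · C(N+d−1, d−1)^{−1} · Π_{i=1}^d ‖T_i‖². Then dEt([[T*, T]]) is trace class and trace(dEt([[T*, T]])) ≤ m · θ · d! · Π_{i=1}^d ‖T_i‖². -/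
open ContinuousLinearMap MeasureTheory
open scoped ENNReal NNReal ComplexOrder

noncomputable section

variable {H H₁ H₂ K : Type*}
variable [NormedAddCommGroup H] [InnerProductSpace ℂ H] [CompleteSpace H]
variable [NormedAddCommGroup H₁] [InnerProductSpace ℂ H₁] [CompleteSpace H₁]
variable [NormedAddCommGroup H₂] [InnerProductSpace ℂ H₂] [CompleteSpace H₂]
variable [NormedAddCommGroup K] [InnerProductSpace ℂ K] [CompleteSpace K]

/-- The commutator `[A, B] = A * B - B * A` of two bounded operators. -/
def cmt (A B : H →L[ℂ] H) : H →L[ℂ] H := A * B - B * A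

/-- A bounded operator `T` is hyponormal if `[T*, T] ≥ 0`. -/
def Hyponormal (T : H →L[ℂ] H) : Prop := (cmt (adjoint T) T).IsPositive

/-- A `d`-tuple is projectively hyponormal if every linear combination is hyponormal. -/
def ProjHyponormal {d : ℕ} (T : Fin d → H →L[ℂ] H) : Prop :=
  ∀ α : Fin d → ℂ, Hyponormal (∑ i, α i • T i)

/-- A `d`-tuple is jointly hyponormal if the block operator `(([T j*, T i]))` is
non-negative definite on the `d`-fold direct sum. -/
def JointlyHyponormal {d : ℕ} (T : Fin d → H →L[ℂ] H) : Prop :=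
  ∀ x : Fin d → H, 0 ≤ ∑ i, ∑ j, @inner ℂ _ _ (x i) (cmt (adjoint (T j)) (T i) (x j))

/-- The trace norm `‖T‖₁ = sup Σ |⟨T fᵢ, gᵢ⟩|`, the supremum being taken over all pairs of
(finite) orthonormal families. -/
def traceNorm (T : H →L[ℂ] H) : ℝ≥0∞ :=
  ⨆ (n : ℕ) (f : Fin n → H) (g : Fin n → H) (_ : Orthonormal ℂ f) (_ : Orthonormal ℂ g),
    ∑ i, (‖@inner ℂ _ _ (T (f i)) (g i)‖₊ : ℝ≥0∞)

/-- A bounded operator is trace class if its trace norm is finite. -/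
def IsTraceClass (T : H →L[ℂ] H) : Prop := traceNorm T ≠ ⊤

/-- The Hilbert-Schmidt norm `‖T‖₂ = (Σ ‖T eₙ‖²)^(1/2)`. -/
def hsNorm (T : H →L[ℂ] H) : ℝ≥0∞ :=
  (⨆ (n : ℕ) (f : Fin n → H) (_ : Orthonormal ℂ f), ∑ i, (‖T (f i)‖₊ : ℝ≥0∞) ^ 2) ^ (1/2 : ℝ)

/-- The word `T₁^(n 1) ⋯ T d^(n d)` in a `d`-tuple of operators. -/
def opWord {d : ℕ} (T : Fin d → H →L[ℂ] H) (n : Fin d → ℕ) : H →L[ℂ] H :=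
  (List.ofFn fun j => (T j) ^ (n j)).prod

/-- A single operator is `m`-polynomially cyclic if `m` is the least cardinality of a finite
set `ξ` such that the span of `{T^n v : v ∈ ξ, n ≥ 0}` is dense. -/
def IsPolyCyclicOp (T : H →L[ℂ] H) (m : ℕ) : Prop :=
  IsLeast {k : ℕ | ∃ ξ : Finset H, ξ.card = k ∧
    Dense ((Submodule.span ℂ {x | ∃ v ∈ ξ, ∃ n : ℕ, x = (T ^ n) v} : Submodule ℂ H) : Set H)} m

/-- A commuting `d`-tuple is `m`-polynomially cyclic if `m` is the least cardinality of a finite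
set `ξ` such that the span of `{T₁^{i₁} ⋯ T_d^{i_d} v : v ∈ ξ}` is dense. -/
def IsPolyCyclicTuple {d : ℕ} (T : Fin d → H →L[ℂ] H) (m : ℕ) : Prop :=
  IsLeast {k : ℕ | ∃ ξ : Finset H, ξ.card = k ∧
    Dense ((Submodule.span ℂ {x | ∃ v ∈ ξ, ∃ n : Fin d → ℕ, x = opWord T n v} :
      Submodule ℂ H) : Set H)} m

/-- The determinant operator `dEt [[T*, T]]` of the block operator of commutators
`B i j = [T j*, T i]`, given by the symmetrized Laplace expansion. -/
def detOp {d : ℕ} (T : Fin d → H →L[ℂ] H) : H →L[ℂ] H :=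
  ∑ σ : Equiv.Perm (Fin d), ∑ τ : Equiv.Perm (Fin d),
    ((Equiv.Perm.sign σ : ℤ) •
      (List.ofFn fun k => cmt (adjoint (T (σ (τ k)))) (T (τ k))).prod)

/-- The standard polynomial `S n (A 1, …, A n) = Σ_σ sgn σ • A σ(1) ⋯ A σ(n)`. -/
def stdPoly {n : ℕ} (A : Fin n → H →L[ℂ] H) : H →L[ℂ] H :=
  ∑ σ : Equiv.Perm (Fin n), ((Equiv.Perm.sign σ : ℤ) • (List.ofFn fun k => A (σ k)).prod)

/-- The generalized commutator `GC(T*, T) = S_{2d}(T₁*, T₁, …, T_d*, T_d)` of Helton-Howe. -/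
def genComm {d : ℕ} (T : Fin d → H →L[ℂ] H) : H →L[ℂ] H :=
  stdPoly (fun j : Fin (2 * d) =>
    if (j : ℕ) % 2 = 0 then adjoint (T ⟨(j : ℕ) / 2, by have := j.isLt; omega⟩)
    else T ⟨(j : ℕ) / 2, by have := j.isLt; omega⟩)

/-- `P` is the orthogonal projection onto the subspace `K'`. -/
def IsOrthProjOn (P : H →L[ℂ] H) (K' : Submodule ℂ H) : Prop :=
  IsSelfAdjoint P ∧ (∀ x, P x ∈ K') ∧ (∀ x ∈ K', P x = x)

/-- The subspace `H_N` spanned by words of total degree at most `N` applied to `ξ`. -/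
def HN {d : ℕ} (T : Fin d → H →L[ℂ] H) (ξ : Finset H) (N : ℕ) : Submodule ℂ H :=
  Submodule.span ℂ {x | ∃ v ∈ ξ, ∃ n : Fin d → ℕ, (∑ j, n j) ≤ N ∧ x = opWord T n v}

/-- The word `T*_{η 1} T_{τ 1} T*_{η 2} T_{τ 2} ⋯ T_{τ (d-1)} T*_{η d}`. -/
def wordB {d : ℕ} (T : Fin d → H →L[ℂ] H) (η τ : Equiv.Perm (Fin d)) : H →L[ℂ] H :=
  (List.ofFn fun k : Fin d =>
    if (k : ℕ) + 1 = d then adjoint (T (η k)) else adjoint (T (η k)) * T (τ k)).prod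

/-- The operator `P_N (Σ_η sgn η T*_{η 1} T_{τ 1} ⋯ T*_{η d}) P_N^⊥ T_{τ d} P_N`. -/
def bsExpr {d : ℕ} (hd : 0 < d) (T : Fin d → H →L[ℂ] H) (P : ℕ → H →L[ℂ] H)
    (τ : Equiv.Perm (Fin d)) (N : ℕ) : H →L[ℂ] H :=
  P N * (∑ η : Equiv.Perm (Fin d), (Equiv.Perm.sign η : ℤ) • wordB T η τ) *
    ((1 - P N) * T (τ ⟨d - 1, by omega⟩) * P N)

/-- The class `BS_{m, θ}`. -/
def InBS {d : ℕ} (hd : 0 < d) (T : Fin d → H →L[ℂ] H) (m θ : ℕ) : Prop :=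
  IsPolyCyclicTuple T m ∧ (detOp T).IsPositive ∧
  ∃ ξ : Finset H, ξ.card = m ∧
    Dense ((Submodule.span ℂ {x | ∃ v ∈ ξ, ∃ n : Fin d → ℕ, x = opWord T n v} :
      Submodule ℂ H) : Set H) ∧
    ∃ P : ℕ → H →L[ℂ] H, (∀ N, IsOrthProjOn (P N) (HN T ξ N)) ∧
      (∀ (N : ℕ) (j : Fin d), P N * T j * (1 - P N) = 0) ∧
      (∀ (τ : Equiv.Perm (Fin d)) (N : ℕ),
        ‖bsExpr hd T P τ N‖ ≤
          (θ : ℝ) * (((N + d - 1).choose (d - 1) : ℝ))⁻¹ * ∏ i, ‖T i‖ ^ 2)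

/-- Evaluation of a polynomial in `d` commuting variables on a commuting `d`-tuple. -/
def evalPoly {d : ℕ} (T : Fin d → H →L[ℂ] H) (p : MvPolynomial (Fin d) ℂ) : H →L[ℂ] H :=
  ∑ mo ∈ p.support, MvPolynomial.coeff mo p • opWord T (fun i => mo i)

/-- A pure hyponormal operator: no nonzero closed subspace, reducing for `T`, on which `T`
restricts to a normal operator. -/
def IsPureHyponormal (T : H →L[ℂ] H) : Prop :=
  Hyponormal T ∧ ∀ K' : Submodule ℂ H, IsClosed (K' : Set H) →
    (∀ x ∈ K', T x ∈ K') → (∀ x ∈ K', adjoint T x ∈ K') →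
    (∀ x ∈ K', ‖T x‖ = ‖adjoint T x‖) → K' = ⊥

/-- `tmul` realises `H` as the Hilbert space tensor product of `H₁` and `H₂`. -/
structure IsHilbertTensor (tmul : H₁ →ₗ[ℂ] H₂ →ₗ[ℂ] H) : Prop where
  inner_tmul : ∀ x₁ x₂ y₁ y₂,
    @inner ℂ _ _ (tmul x₁ x₂) (tmul y₁ y₂) = @inner ℂ _ _ x₁ y₁ * @inner ℂ _ _ x₂ y₂
  dense_span :
    Dense ((Submodule.span ℂ {z | ∃ x y, z = tmul x y} : Submodule ℂ H) : Set H)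

/-- `C` is the tensor product operator `A ⊗ B` relative to `tmul`. -/
def IsTensorOp (tmul : H₁ →ₗ[ℂ] H₂ →ₗ[ℂ] H) (A : H₁ →L[ℂ] H₁) (B : H₂ →L[ℂ] H₂)
    (C : H →L[ℂ] H) : Prop :=
  ∀ x y, C (tmul x y) = tmul (A x) (B y)
theorem aux_prod_congr {M : Type*} [Monoid M] : ∀ {n : ℕ} (i : Fin n) (f g : Fin (n+1) → M)
    (_ : ∀ k, k ≠ i.castSucc → k ≠ i.succ → f k = g k)
    (_ : f i.castSucc * f i.succ = g i.castSucc * g i.succ),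
    (List.ofFn f).prod = (List.ofFn g).prod := by
  intro n
  induction n with
  | zero => intro i; exact i.elim0
  | succ n ih =>
    intro i f g h1 h2
    induction i using Fin.cases with
    | zero =>
      rw [List.ofFn_succ, List.ofFn_succ, List.ofFn_succ (f := g), List.ofFn_succ (f := fun i => g i.succ)]
      simp only [List.prod_cons, ← mul_assoc]
      have h2' : f 0 * f (Fin.succ 0) = g 0 * g (Fin.succ 0) := h2
      rw [h2']
      congr 2
      congr 1
      funext k
      apply h1
      · intro h
        have := congrArg Fin.val h
        simp at this
      · intro h
        have := congrArg Fin.val h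
        simp at this
    | succ i =>
      rw [List.ofFn_succ, List.ofFn_succ (f := g)]
      simp only [List.prod_cons]
      rw [ih i (fun k => f k.succ) (fun k => g k.succ)]
      · rw [h1 0]
        · intro h
          have := congrArg Fin.val h
          simp at this
        · intro h
          have := congrArg Fin.val h
          simp at this
      · intro k hk1 hk2
        apply h1
        · intro h
          apply hk1
          have := congrArg Fin.val h
          simp at this
          exact Fin.ext this
        · intro h
          apply hk2
          exact Fin.succ_injective _ h
      · exact h2

theorem aux_adj {n : ℕ} (s : Finset (Fin (n+1))) (h0 : s ≠ ∅) (h1 : s ≠ Finset.univ) :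
    ∃ i : Fin n, (i.castSucc ∈ s ∧ i.succ ∉ s) ∨ (i.castSucc ∉ s ∧ i.succ ∈ s) := by
  by_contra! hcon
  have key : ∀ k : Fin (n+1), (k ∈ s ↔ (0 : Fin (n+1)) ∈ s) := by
    intro k
    induction k using Fin.induction with
    | zero => rfl
    | succ i ih =>
      have := hcon i
      tauto
  by_cases hz : (0 : Fin (n+1)) ∈ s
  · exact h1 (Finset.eq_univ_iff_forall.2 fun k => (key k).2 hz)
  · exact h0 (Finset.eq_empty_iff_forall_notMem.2 fun k hk => hz ((key k).1 hk))

theorem aux_sum_zero {R : Type*} [Ring R] {n : ℕ} (i : Fin n) (f : Equiv.Perm (Fin (n+1)) → R)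
    (h : ∀ η : Equiv.Perm (Fin (n+1)), f (η * Equiv.swap i.castSucc i.succ) = f η) :
    ∑ η : Equiv.Perm (Fin (n+1)), (Equiv.Perm.sign η : ℤ) • f η = 0 := by
  have hne : i.castSucc ≠ i.succ := (Fin.castSucc_lt_succ).ne
  refine Finset.sum_involution (fun η _ => η * Equiv.swap i.castSucc i.succ) ?_ ?_ ?_ ?_
  · intro η _
    rw [h, Equiv.Perm.sign_mul, Equiv.Perm.sign_swap hne]
    simp
  · intro η _ _ hc
    have := mul_eq_left.1 hc
    exact hne (Equiv.swap_eq_one_iff.1 this)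
  · intro η _
    simp
  · intro η _
    simp [mul_assoc]

theorem aux_shift {M : Type*} [Monoid M] : ∀ {n : ℕ} (a b : Fin (n+1) → M),
    (List.ofFn fun k => b k * a k).prod =
      b 0 * ((List.ofFn fun k : Fin n => a k.castSucc * b k.succ).prod * a (Fin.last n)) := by
  intro n
  induction n with
  | zero => intro a b; simp
  | succ n ih =>
    intro a b
    rw [List.ofFn_succ, List.prod_cons, ih (fun k => a k.succ) (fun k => b k.succ),
      List.ofFn_succ (n := n), List.prod_cons]
    simp [mul_assoc]

theorem aux_neg {R : Type*} [Ring R] : ∀ {n : ℕ} (f : Fin n → R),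
    (List.ofFn fun k => - f k).prod = (-1 : ℤ) ^ n • (List.ofFn f).prod := by
  intro n
  induction n with
  | zero => intro f; simp
  | succ n ih =>
    intro f
    rw [List.ofFn_succ, List.prod_cons, ih (fun k => f k.succ), List.ofFn_succ, List.prod_cons,
      pow_succ', mul_smul_comm, neg_mul, neg_one_mul, neg_smul, smul_neg]

/-- the generic alternating word -/
def auxW {R : Type*} [Ring R] {n : ℕ} (A B : Fin (n+1) → R) (η τ : Equiv.Perm (Fin (n+1))) : R :=
  (List.ofFn fun k : Fin n => A (η k.castSucc) * B (τ k.castSucc)).prod * A (η (Fin.last n))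

theorem aux_rot {n : ℕ} (k : Fin n) : finRotate (n+1) k.castSucc = k.succ := by
  simp

theorem aux_det {R : Type*} [Ring R] {n : ℕ} (A B : Fin (n+1) → R)
    (hA : ∀ i j, A i * A j = A j * A i) (hB : ∀ i j, B i * B j = B j * B i) :
    (∑ σ : Equiv.Perm (Fin (n+1)), ∑ τ : Equiv.Perm (Fin (n+1)),
      ((Equiv.Perm.sign σ : ℤ) •
        (List.ofFn fun k => A (σ (τ k)) * B (τ k) - B (τ k) * A (σ (τ k))).prod)) =
    ∑ τ : Equiv.Perm (Fin (n+1)), (Equiv.Perm.sign τ : ℤ) •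
      ((∑ η : Equiv.Perm (Fin (n+1)), (Equiv.Perm.sign η : ℤ) • auxW A B η τ) * B (τ (Fin.last n))
       - B (τ (Fin.last n)) *
        (∑ η : Equiv.Perm (Fin (n+1)), (Equiv.Perm.sign η : ℤ) • auxW A B η τ)) := by
  classical
  let G : Finset (Fin (n+1)) → Equiv.Perm (Fin (n+1)) → Equiv.Perm (Fin (n+1)) → R := fun s η τ =>
    (List.ofFn (s.piecewise (fun k => A (η k) * B (τ k)) (fun k => - (B (τ k) * A (η k))))).prod
  have hexp : ∀ η τ : Equiv.Perm (Fin (n+1)),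
      (List.ofFn fun k => A (η k) * B (τ k) - B (τ k) * A (η k)).prod = ∑ s, G s η τ := by
    intro η τ
    have := (MultilinearMap.mkPiAlgebraFin ℤ (n+1) R).map_add_univ
      (fun k => A (η k) * B (τ k)) (fun k => - (B (τ k) * A (η k)))
    simp only [MultilinearMap.mkPiAlgebraFin_apply] at this
    rw [← this]
    congr 2
    funext k
    simp [sub_eq_add_neg]
  -- reindex
  have h1 : (∑ σ : Equiv.Perm (Fin (n+1)), ∑ τ : Equiv.Perm (Fin (n+1)),
      ((Equiv.Perm.sign σ : ℤ) •
        (List.ofFn fun k => A (σ (τ k)) * B (τ k) - B (τ k) * A (σ (τ k))).prod)) =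
      ∑ τ : Equiv.Perm (Fin (n+1)), (Equiv.Perm.sign τ : ℤ) •
        ∑ η : Equiv.Perm (Fin (n+1)), (Equiv.Perm.sign η : ℤ) • ∑ s, G s η τ := by
    rw [Finset.sum_comm]
    refine Finset.sum_congr rfl fun τ _ => ?_
    rw [Finset.smul_sum]
    refine Fintype.sum_equiv (Equiv.mulRight τ) _ _ fun σ => ?_
    rw [← hexp, smul_smul]
    simp only [Equiv.coe_mulRight, Equiv.Perm.sign_mul, Equiv.Perm.mul_apply]
    congr 1
    have : ((Equiv.Perm.sign τ : ℤ)) * (Equiv.Perm.sign τ : ℤ) = 1 := by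
      rw [← Units.val_mul, Int.units_mul_self]; rfl
    push_cast
    rw [mul_comm (Equiv.Perm.sign σ : ℤ), ← mul_assoc, this, one_mul]
  let F : Finset (Fin (n+1)) → R := fun s => ∑ τ : Equiv.Perm (Fin (n+1)), (Equiv.Perm.sign τ : ℤ) •
        ∑ η : Equiv.Perm (Fin (n+1)), (Equiv.Perm.sign η : ℤ) • G s η τ
  have h2 : (∑ τ : Equiv.Perm (Fin (n+1)), (Equiv.Perm.sign τ : ℤ) •
        ∑ η : Equiv.Perm (Fin (n+1)), (Equiv.Perm.sign η : ℤ) • ∑ s, G s η τ) = ∑ s, F s := by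
    simp only [F, Finset.smul_sum]
    rw [Finset.sum_comm' (s := Finset.univ) (t := fun _ => Finset.univ) (t' := Finset.univ)
      (s' := fun _ => Finset.univ) (by simp)]
    conv_rhs => rw [Finset.sum_comm]
    rw [Finset.sum_comm]
    refine Finset.sum_congr rfl fun τ _ => ?_
    rw [Finset.sum_comm]
  have hswap : ∀ (i : Fin n) (η : Equiv.Perm (Fin (n+1))) (k : Fin (n+1)), k ≠ i.castSucc →
      k ≠ i.succ → (η * Equiv.swap i.castSucc i.succ) k = η k := by
    intro i η k hk1 hk2
    rw [Equiv.Perm.mul_apply, Equiv.swap_apply_of_ne_of_ne hk1 hk2]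
  have h3 : ∀ s, s ≠ ∅ → s ≠ Finset.univ → F s = 0 := by
    intro s hs0 hs1
    obtain ⟨i, hi | hi⟩ := aux_adj s hs0 hs1
    · refine aux_sum_zero i _ fun τ => ?_
      refine Finset.sum_congr rfl fun η _ => ?_
      congr 1
      refine aux_prod_congr i _ _ ?_ ?_
      · intro k hk1 hk2
        by_cases hk : k ∈ s <;> simp only [Finset.piecewise, hk, if_true, if_false, hswap i τ k hk1 hk2]
      · simp only [Finset.piecewise, hi.1, hi.2, if_true, if_false, Equiv.Perm.mul_apply,
          Equiv.swap_apply_left, Equiv.swap_apply_right, mul_neg, mul_assoc]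
        rw [← mul_assoc (B _) (B _), hB, mul_assoc]
    · refine Finset.sum_eq_zero fun τ _ => ?_
      rw [aux_sum_zero i _ fun η => ?_, smul_zero]
      refine aux_prod_congr i _ _ ?_ ?_
      · intro k hk1 hk2
        by_cases hk : k ∈ s <;> simp only [Finset.piecewise, hk, if_true, if_false, hswap i η k hk1 hk2]
      · simp only [Finset.piecewise, hi.1, hi.2, if_true, if_false, Equiv.Perm.mul_apply,
          Equiv.swap_apply_left, Equiv.swap_apply_right, neg_mul, mul_assoc]
        rw [← mul_assoc (A _) (A _), hA, mul_assoc]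
  have h4 : ∑ s, F s = F Finset.univ + F ∅ := by
    rw [← Finset.sum_pair (f := F) (a := Finset.univ) (b := ∅)]
    · refine (Finset.sum_subset (Finset.subset_univ _) ?_).symm
      intro s _ hs
      simp only [Finset.mem_insert, Finset.mem_singleton, not_or] at hs
      exact h3 s hs.2 hs.1
    · exact Finset.univ_nonempty.ne_empty
  have h5 : F Finset.univ = ∑ τ : Equiv.Perm (Fin (n+1)), (Equiv.Perm.sign τ : ℤ) •
      ((∑ η : Equiv.Perm (Fin (n+1)), (Equiv.Perm.sign η : ℤ) • auxW A B η τ) *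
        B (τ (Fin.last n))) := by
    refine Finset.sum_congr rfl fun τ _ => ?_
    rw [Finset.sum_mul]
    congr 1
    refine Finset.sum_congr rfl fun η _ => ?_
    rw [smul_mul_assoc]
    congr 1
    simp only [G, Finset.piecewise_univ, auxW]
    rw [List.ofFn_succ']
    simp [mul_assoc]
  have h6 : F ∅ = - ∑ τ : Equiv.Perm (Fin (n+1)), (Equiv.Perm.sign τ : ℤ) •
      (B (τ (Fin.last n)) *
      (∑ η : Equiv.Perm (Fin (n+1)), (Equiv.Perm.sign η : ℤ) • auxW A B η τ)) := by
    rw [← Finset.sum_neg_distrib]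
    refine Fintype.sum_equiv (Equiv.mulRight (finRotate (n+1))) _ _ fun τ => ?_
    simp only [Equiv.coe_mulRight, Equiv.Perm.sign_mul, Equiv.Perm.mul_apply, sign_finRotate,
      finRotate_last]
    have : ∀ η, G ∅ η τ = (-1 : ℤ)^(n+1) • (B (τ 0) * auxW A B η (τ * finRotate (n+1))) := by
      intro η
      simp only [G, Finset.piecewise_empty, auxW]
      rw [aux_neg, aux_shift (fun k => A (η k)) (fun k => B (τ k))]
      simp only [Equiv.Perm.mul_apply, aux_rot]
    simp only [this]
    rw [Finset.mul_sum, Finset.smul_sum, Finset.smul_sum, ← Finset.sum_neg_distrib]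
    refine Finset.sum_congr rfl fun η _ => ?_
    rw [mul_smul_comm, smul_smul, smul_smul, smul_smul, ← neg_smul]
    congr 1
    push_cast
    ring
  rw [h1, h2, h4, h5, h6, ← sub_eq_add_neg, ← Finset.sum_sub_distrib]
  refine Finset.sum_congr rfl fun τ _ => ?_
  rw [smul_sub]

theorem aux_op_mul {M : Type*} [Monoid M] : ∀ {d : ℕ} (T : Fin d → M)
    (_ : ∀ i j, Commute (T i) (T j)) (n : Fin d → ℕ) (j : Fin d),
    T j * (List.ofFn fun k => T k ^ n k).prod =
      (List.ofFn fun k => T k ^ ((n + Pi.single j 1 : Fin d → ℕ) k)).prod := by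
  intro d
  induction d with
  | zero => intro T _ n j; exact j.elim0
  | succ d ih =>
    intro T hT n j
    rw [List.ofFn_succ, List.ofFn_succ, List.prod_cons, List.prod_cons]
    induction j using Fin.cases with
    | zero =>
      rw [← mul_assoc, ← pow_succ']
      simp
    | succ j =>
      rw [← mul_assoc, ((hT j.succ 0).pow_right _).eq, mul_assoc,
        ih (fun k => T k.succ) (fun i j => hT _ _) (fun k => n k.succ) j]
      simp [Pi.single_apply]

/-- span of words of degree less than `N` -/
def auxK {d : ℕ} (T : Fin d → H →L[ℂ] H) (ξ : Finset H) (N : ℕ) : Submodule ℂ H :=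
  Submodule.span ℂ {x | ∃ v ∈ ξ, ∃ n : Fin d → ℕ, (∑ j, n j) < N ∧ x = opWord T n v}


theorem aux_K_map {d : ℕ} (T : Fin d → H →L[ℂ] H) (hT : ∀ i j, Commute (T i) (T j))
    (ξ : Finset H) (N : ℕ) (j : Fin d) (x : H) (hx : x ∈ auxK T ξ N) : T j x ∈ HN T ξ N := by
  have : auxK T ξ N ≤ (HN T ξ N).comap (T j : H →ₗ[ℂ] H) := by
    refine Submodule.span_le.2 ?_
    rintro _ ⟨v, hv, n, hn, rfl⟩
    refine Submodule.subset_span ⟨v, hv, n + Pi.single j 1, ?_, ?_⟩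
    · simp only [Pi.add_apply, Finset.sum_add_distrib, Finset.sum_pi_single', Finset.mem_univ, if_true]
      simp
      omega
    · unfold opWord
      rw [← aux_op_mul T hT]
      rfl
  exact this hx


theorem aux_K_le {d : ℕ} (T : Fin d → H →L[ℂ] H) (ξ : Finset H) (N : ℕ) :
    auxK T ξ N ≤ HN T ξ N := by
  refine Submodule.span_mono ?_
  rintro _ ⟨v, hv, n, hn, rfl⟩
  exact ⟨v, hv, n, hn.le, rfl⟩

theorem aux_finite (d N : ℕ) : {n : Fin d → ℕ | ∑ j, n j ≤ N}.Finite := by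
  refine (Set.finite_Iic (fun _ : Fin d => N)).subset ?_
  intro n hn j
  exact (Finset.single_le_sum (f := n) (fun _ _ => Nat.zero_le _) (Finset.mem_univ j)).trans hn


theorem aux_HN_fd {d : ℕ} (T : Fin d → H →L[ℂ] H) (ξ : Finset H) (N : ℕ) :
    FiniteDimensional ℂ (HN T ξ N) := by
  refine FiniteDimensional.span_of_finite ℂ ?_
  have : ((fun p : H × (Fin d → ℕ) => opWord T p.2 p.1) ''
    ((ξ : Set H) ×ˢ {n : Fin d → ℕ | ∑ j, n j ≤ N})).Finite :=
    (ξ.finite_toSet.prod (aux_finite d N)).image _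
  refine this.subset ?_
  rintro _ ⟨v, hv, n, hn, rfl⟩
  exact ⟨(v, n), ⟨hv, hn⟩, rfl⟩


theorem aux_finrank {d : ℕ} (T : Fin (d+1) → H →L[ℂ] H) (ξ : Finset H) (N : ℕ) :
    Module.finrank ℂ (HN T ξ N) ≤ Module.finrank ℂ (auxK T ξ N) + ξ.card * (N + d).choose d := by
  classical
  have := aux_HN_fd T ξ N
  let F : Finset H := (ξ ×ˢ (Finset.univ : Finset (Fin (d+1))).finsuppAntidiag N).image
    (fun p => opWord T p.2 p.1)
  have hF : F.card ≤ ξ.card * (N + d).choose d := by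
    refine Finset.card_image_le.trans ?_
    rw [Finset.card_product, Finset.card_finsuppAntidiag_nat_eq_choose]
    simp only [Finset.card_univ, Fintype.card_fin]
    rw [show d + 1 + N - 1 = N + d by omega, Nat.choose_symm_add]
  have hle : HN T ξ N ≤ auxK T ξ N ⊔ Submodule.span ℂ (F : Set H) := by
    refine Submodule.span_le.2 ?_
    rintro _ ⟨v, hv, n, hn, rfl⟩
    rcases hn.lt_or_eq with h | h
    · exact Submodule.mem_sup_left (Submodule.subset_span ⟨v, hv, n, h, rfl⟩)
    · refine Submodule.mem_sup_right (Submodule.subset_span ?_)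
      simp only [F, Finset.coe_image, Set.mem_image]
      refine ⟨(v, Finsupp.equivFunOnFinite.symm n), ?_, rfl⟩
      simp [hv, Finset.mem_finsuppAntidiag, h]
  have hK : FiniteDimensional ℂ (auxK T ξ N) :=
    Submodule.finiteDimensional_of_le (aux_K_le T ξ N)
  calc Module.finrank ℂ (HN T ξ N) ≤ Module.finrank ℂ ↥(auxK T ξ N ⊔ Submodule.span ℂ (F : Set H)) :=
        Submodule.finrank_mono hle
    _ ≤ Module.finrank ℂ (auxK T ξ N) + Module.finrank ℂ (Submodule.span ℂ (F : Set H)) :=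
        Submodule.finrank_add_le_finrank_add_finrank _ _
    _ ≤ _ := by
        gcongr
        exact (finrank_span_finset_le_card F).trans hF

theorem aux_proj {P : H →L[ℂ] H} {U : Submodule ℂ H} [U.HasOrthogonalProjection]
    (h : IsOrthProjOn P U) : P = U.starProjection := by
  ext x
  symm
  refine Submodule.eq_starProjection_of_mem_orthogonal (h.2.1 x) ?_
  rw [Submodule.mem_orthogonal]
  intro u hu
  have h1 : inner ℂ u (P x) = inner ℂ (P u) x := by
    rw [← ContinuousLinearMap.adjoint_inner_left, h.1.adjoint_eq]
  rw [inner_sub_right, h1, h.2.2 u hu, sub_self]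

theorem aux_norm {E : Type*} [NormedAddCommGroup E] [InnerProductSpace ℂ E]
    (U : Submodule ℂ E) [U.HasOrthogonalProjection] (A : E →L[ℂ] E) :
    ‖U.orthogonalProjectionOnto ∘L A ∘L U.subtypeL‖ ≤ ‖A‖ := by
  refine ContinuousLinearMap.opNorm_le_bound _ (norm_nonneg A) fun x => ?_
  have h1 : ‖U.orthogonalProjectionOnto (A (x : E))‖ ≤ ‖A (x : E)‖ :=
    Submodule.norm_orthogonalProjectionOnto_apply_le U (A (x : E))
  have h2 : ‖A (x : E)‖ ≤ ‖A‖ * ‖(x : E)‖ := A.le_opNorm (x : E)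
  exact h1.trans h2

/-- compression to a subspace -/
def auxC (U : Submodule ℂ H) [U.HasOrthogonalProjection] (A : H →L[ℂ] H) : U →L[ℂ] U :=
  U.orthogonalProjectionOnto ∘L A ∘L U.subtypeL


theorem auxC_apply (U : Submodule ℂ H) [U.HasOrthogonalProjection] (A : H →L[ℂ] H) (x : U) :
    auxC U A x = U.orthogonalProjectionOnto (A x) := rfl

/-- trace of the compression -/
def auxTr (U : Submodule ℂ H) [U.HasOrthogonalProjection] : (H →L[ℂ] H) →ₗ[ℂ] ℂ where
  toFun A := LinearMap.trace ℂ U (auxC U A : U →ₗ[ℂ] U)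
  map_add' A B := by
    rw [← map_add]; congr 1; ext x; simp [auxC]
  map_smul' c A := by
    rw [← map_smul]; congr 1; ext x; simp [auxC]


theorem aux_trace_le {U : Type*} [NormedAddCommGroup U] [InnerProductSpace ℂ U]
    [FiniteDimensional ℂ U] (X : U →L[ℂ] U) :
    ‖LinearMap.trace ℂ U (X : U →ₗ[ℂ] U)‖ ≤ Module.finrank ℂ U * ‖X‖ := by
  rw [LinearMap.trace_eq_sum_inner _ (stdOrthonormalBasis ℂ U)]
  refine (norm_sum_le _ _).trans ?_
  have : ∀ i ∈ (Finset.univ : Finset (Fin (Module.finrank ℂ U))),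
      ‖inner ℂ (stdOrthonormalBasis ℂ U i) ((X : U →ₗ[ℂ] U) (stdOrthonormalBasis ℂ U i))‖ ≤ ‖X‖ := by
    intro i _
    refine (norm_inner_le_norm _ _).trans ?_
    simpa using X.le_opNorm (stdOrthonormalBasis ℂ U i)
  refine (Finset.sum_le_sum this).trans ?_
  simp

theorem aux_trace_le' {U : Type*} [NormedAddCommGroup U] [InnerProductSpace ℂ U]
    [FiniteDimensional ℂ U] (X : U →L[ℂ] U) (K : Submodule ℂ U) (hK : ∀ x ∈ K, X x = 0) :
    ‖LinearMap.trace ℂ U (X : U →ₗ[ℂ] U)‖ ≤ Module.finrank ℂ Kᗮ * ‖X‖ := by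
  have h1 : (X : U →ₗ[ℂ] U) = ((X ∘L Kᗮ.subtypeL : Kᗮ →L[ℂ] U) : Kᗮ →ₗ[ℂ] U) ∘ₗ
      (Kᗮ.orthogonalProjectionOnto : U →ₗ[ℂ] Kᗮ) := by
    ext x
    have := Submodule.sub_starProjection_mem_orthogonal (K := Kᗮ) x
    rw [Submodule.orthogonal_orthogonal] at this
    have h := hK _ this
    rw [map_sub, sub_eq_zero] at h
    simpa using h
  rw [h1, LinearMap.trace_comp_comm']
  have h2 := aux_trace_le (Kᗮ.orthogonalProjectionOnto ∘L X ∘L Kᗮ.subtypeL)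
  exact h2.trans (mul_le_mul_of_nonneg_left (aux_norm Kᗮ X) (Nat.cast_nonneg _))

theorem aux_comm {P : H →L[ℂ] H} {U : Submodule ℂ H} [FiniteDimensional ℂ U]
    (hP : P = U.starProjection) (W T : H →L[ℂ] H) (hT : P * T * (1 - P) = 0) :
    auxTr U (W * T - T * W) = auxTr U (P * W * ((1 - P) * T * P)) := by
  have h1 : auxTr U (W * P * T) = auxTr U (T * P * W) := by
    have : ∀ A B : H →L[ℂ] H, auxTr U (A * P * B) = LinearMap.trace ℂ U
      ((auxC U A : U →ₗ[ℂ] U) * (auxC U B : U →ₗ[ℂ] U)) := by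
      intro A B
      simp only [auxTr, LinearMap.coe_mk, AddHom.coe_mk]
      congr 1
      ext x
      simp [auxC, hP]
    rw [this, this, LinearMap.trace_mul_comm]
  have hz : ∀ x, P x = U.orthogonalProjectionOnto x := by
    intro x; rw [hP]; rfl
  have h2 : auxTr U (T * (1 - P) * W) = 0 := by
    have : auxC U (T * (1 - P) * W) = 0 := by
      ext x
      have := DFunLike.congr_fun hT (W x)
      simp only [mul_apply_eq_comp] at this
      rw [hz] at this
      simpa [auxC] using this
    simp [auxTr, this]
  have h3 : auxTr U (P * W * ((1 - P) * T * P)) = auxTr U (W * (1 - P) * T) := by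
    simp only [auxTr, LinearMap.coe_mk, AddHom.coe_mk]
    congr 1
    ext x
    have hid : ∀ y, U.starProjection (U.starProjection y) = U.starProjection y := fun y =>
      Submodule.starProjection_eq_self_iff.2 (Submodule.starProjection_apply_mem U y)
    simp [auxC, hP, hid]
  rw [h3]
  have e1 : W * T - T * W = (W * P * T - T * P * W) + (W * (1 - P) * T - T * (1 - P) * W) := by
    noncomm_ring
  rw [e1, map_add, map_sub, map_sub, h1, h2]
  simp

theorem aux_bessel (S : H →L[ℂ] H) (hS : S.IsPositive) (U : Submodule ℂ H)
    [FiniteDimensional ℂ U] {n : ℕ} (f : Fin n → H) (hf : Orthonormal ℂ f) :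
    ∑ i, (inner ℂ (S (U.starProjection (f i))) (U.starProjection (f i))).re ≤ (auxTr U S).re := by
  have hpos : (auxC U S).IsPositive := hS.orthogonalProjectionOnto_comp U
  obtain ⟨k, u, hu⟩ := ContinuousLinearMap.isPositive_iff_eq_sum_rankOne.1 hpos
  have htr : auxTr U S = ∑ j, ((‖u j‖ ^ 2 : ℝ) : ℂ) := by
    simp only [auxTr, LinearMap.coe_mk, AddHom.coe_mk]
    rw [hu]
    simp [InnerProductSpace.trace_rankOne]
  have hin : ∀ x : H, (inner ℂ (S (U.starProjection x)) (U.starProjection x)).re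
      = ∑ j, ‖inner ℂ x (u j : H)‖ ^ 2 := by
    intro x
    have h1 : inner ℂ (S (U.starProjection x)) (U.starProjection x) =
        inner ℂ (auxC U S (U.orthogonalProjectionOnto x)) (U.orthogonalProjectionOnto x) := by
      rw [auxC_apply, Submodule.inner_orthogonalProjectionOnto_eq_of_mem_right]
      rfl
    rw [h1, hu]
    simp only [_root_.sum_apply, InnerProductSpace.rankOne_apply, sum_inner,
      inner_smul_left, Complex.re_sum]
    refine Finset.sum_congr rfl fun j _ => ?_
    rw [inner_conj_symm]
    have : inner ℂ (U.orthogonalProjectionOnto x) (u j) = inner ℂ x (u j : H) :=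
      Submodule.inner_orthogonalProjectionOnto_eq_of_mem_right _ _
    rw [← inner_conj_symm (u j), this, Complex.mul_conj, Complex.normSq_eq_norm_sq]
    norm_cast
  rw [htr]
  simp only [hin]
  rw [Finset.sum_comm, Complex.re_sum]
  refine Finset.sum_le_sum fun j _ => ?_
  rw [Complex.ofReal_re]
  exact hf.sum_inner_products_le (u j : H)

theorem aux_cs (S : H →L[ℂ] H) (hS : S.IsPositive) (x y : H) :
    ‖inner ℂ (S x) y‖ ≤ ((inner ℂ (S x) x).re + (inner ℂ (S y) y).re) / 2 := by
  obtain ⟨c, hc, hcx⟩ : ∃ c : ℂ, ‖c‖ = 1 ∧ c * inner ℂ (S x) y = (‖inner ℂ (S x) y‖ : ℂ) := by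
    by_cases h : inner ℂ (S x) y = 0
    · exact ⟨1, by simp, by simp [h]⟩
    · refine ⟨(‖inner ℂ (S x) y‖ : ℂ) / inner ℂ (S x) y, ?_, ?_⟩
      · rw [norm_div]; simp [h]
      · field_simp
  have h := hS.re_inner_nonneg_left (x - c • y)
  have hsym : inner ℂ (S y) x = (starRingEnd ℂ) (inner ℂ (S x) y) := by
    rw [inner_conj_symm, hS.inner_left_eq_inner_right]
  have hcc : (starRingEnd ℂ) c * c = 1 := by
    rw [mul_comm, Complex.mul_conj, Complex.normSq_eq_norm_sq, hc]; simp
  have e : inner ℂ (S (x - c • y)) (x - c • y) = inner ℂ (S x) x - c * inner ℂ (S x) y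
      - (starRingEnd ℂ) (c * inner ℂ (S x) y) + inner ℂ (S y) y := by
    rw [map_sub, map_smul]
    simp only [inner_sub_left, inner_sub_right, inner_smul_left, inner_smul_right]
    rw [hsym, map_mul]
    linear_combination (inner ℂ (S y) y) * hcc
  rw [e, hcx, Complex.conj_ofReal] at h
  simp at h
  linarith

theorem aux_traceNorm (S : H →L[ℂ] H) (hS : S.IsPositive) (U : ℕ → Submodule ℂ H)
    [∀ N, FiniteDimensional ℂ (U N)] (hmono : Monotone U)
    (hd : ⊤ ≤ (⨆ N, U N).topologicalClosure) (C : ℝ)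
    (hC : ∀ N, (auxTr (U N) S).re ≤ C) : traceNorm S ≤ ENNReal.ofReal C := by
  have key : ∀ {n : ℕ} (f : Fin n → H), Orthonormal ℂ f → ∑ i, (inner ℂ (S (f i)) (f i)).re ≤ C := by
    intro n f hf
    have ht : Filter.Tendsto (fun N => ∑ i, (inner ℂ (S ((U N).starProjection (f i)))
        ((U N).starProjection (f i))).re) Filter.atTop
        (nhds (∑ i, (inner ℂ (S (f i)) (f i)).re)) := by
      refine tendsto_finsetSum _ fun i _ => ?_
      have h := Submodule.starProjection_tendsto_self U hmono (f i) hd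
      have h' := ((S.continuous.tendsto _).comp h).inner (𝕜 := ℂ) h
      exact (Complex.continuous_re.tendsto _).comp h'
    exact le_of_tendsto' ht fun N => (aux_bessel S hS (U N) f hf).trans (hC N)
  unfold traceNorm
  refine iSup_le fun n => iSup_le fun f => iSup_le fun g => iSup_le fun hf => iSup_le fun hg => ?_
  have h1 : ∑ i, ‖inner ℂ (S (f i)) (g i)‖ ≤ C := by
    refine (Finset.sum_le_sum fun i _ => aux_cs S hS (f i) (g i)).trans ?_
    rw [← Finset.sum_div, Finset.sum_add_distrib]
    linarith [key f hf, key g hg]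
  have h2 : ∑ i, (‖inner ℂ (S (f i)) (g i)‖₊ : ℝ≥0∞) =
      ENNReal.ofReal (∑ i, ‖inner ℂ (S (f i)) (g i)‖) := by
    rw [ENNReal.ofReal_sum_of_nonneg fun _ _ => norm_nonneg _]
    simp [ofReal_norm, enorm_eq_nnnorm]
  rw [h2]
  exact ENNReal.ofReal_le_ofReal h1

theorem aux_wordB {n : ℕ} (T : Fin (n+1) → H →L[ℂ] H) (η τ : Equiv.Perm (Fin (n+1))) :
    wordB T η τ = auxW (fun i => adjoint (T i)) T η τ := by
  unfold wordB auxW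
  rw [List.ofFn_succ']
  have : ∀ k : Fin n, ¬ ((k : ℕ) = n) := fun k => k.isLt.ne
  simp [this]

theorem aux_detOp {n : ℕ} (T : Fin (n+1) → H →L[ℂ] H) (hT : ∀ i j, Commute (T i) (T j)) :
    detOp T = ∑ τ : Equiv.Perm (Fin (n+1)), (Equiv.Perm.sign τ : ℤ) •
      ((∑ η : Equiv.Perm (Fin (n+1)), (Equiv.Perm.sign η : ℤ) • wordB T η τ) * T (τ (Fin.last n))
       - T (τ (Fin.last n)) *
        (∑ η : Equiv.Perm (Fin (n+1)), (Equiv.Perm.sign η : ℤ) • wordB T η τ)) := by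
  simp only [aux_wordB]
  refine aux_det (fun i => adjoint (T i)) T ?_ (fun i j => (hT i j).eq)
  intro i j
  have := congrArg star (hT i j).eq
  simpa only [star_mul, ContinuousLinearMap.star_eq_adjoint] using this.symm

/-- for a commuting tuple in the class `BS_{m, θ}`, the determinant operator is
trace class with `trace (dEt[[T*, T]]) ≤ m θ d! Π ‖T i‖²`. -/
theorem statement_17 {d : ℕ} (hd : 0 < d) [TopologicalSpace.SeparableSpace H]
    (T : Fin d → H →L[ℂ] H) (hcomm : ∀ i j, Commute (T i) (T j))
    (m θ : ℕ) (hBS : InBS hd T m θ) :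
    IsTraceClass (detOp T) ∧
      traceNorm (detOp T) ≤
        ENNReal.ofReal ((m : ℝ) * θ * d.factorial * ∏ i, ‖T i‖ ^ 2) := by
  obtain ⟨-, hpos, ξ, hξ, hdense, P, hP, hPT, hbd⟩ := hBS
  obtain ⟨n, rfl⟩ : ∃ n, d = n + 1 := ⟨d - 1, by omega⟩
  have hfd : ∀ N, FiniteDimensional ℂ (HN T ξ N) := aux_HN_fd T ξ
  have hmono : Monotone (HN T ξ) := by
    intro M N hMN
    refine Submodule.span_mono ?_
    rintro _ ⟨v, hv, k, hk, rfl⟩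
    exact ⟨v, hv, k, hk.trans hMN, rfl⟩
  have hcl : ⊤ ≤ (⨆ N, HN T ξ N).topologicalClosure := by
    have hle : Submodule.span ℂ {x | ∃ v ∈ ξ, ∃ n : Fin (n+1) → ℕ, x = opWord T n v} ≤
        ⨆ N, HN T ξ N := by
      refine Submodule.span_le.2 ?_
      rintro _ ⟨v, hv, k, rfl⟩
      exact Submodule.mem_iSup_of_mem (∑ j, k j) (Submodule.subset_span ⟨v, hv, k, le_rfl, rfl⟩)
    intro x _
    exact closure_mono hle (hdense x)
  suffices h : traceNorm (detOp T) ≤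
      ENNReal.ofReal ((m : ℝ) * θ * (n+1).factorial * ∏ i, ‖T i‖ ^ 2) from
    ⟨ne_top_of_le_ne_top ENNReal.ofReal_ne_top h, h⟩
  refine aux_traceNorm _ hpos (HN T ξ) hmono hcl _ fun N => ?_
  have hPN := aux_proj (hP N)
  have htr : auxTr (HN T ξ N) (detOp T) = ∑ τ : Equiv.Perm (Fin (n+1)),
      (Equiv.Perm.sign τ : ℤ) • auxTr (HN T ξ N) (bsExpr hd T P τ N) := by
    rw [aux_detOp T hcomm, map_sum]
    refine Finset.sum_congr rfl fun τ _ => ?_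
    rw [map_zsmul, aux_comm hPN _ _ (hPT N _)]
    rfl
  have hone : ∀ τ : Equiv.Perm (Fin (n+1)),
      ‖auxTr (HN T ξ N) (bsExpr hd T P τ N)‖ ≤ m * θ * ∏ i, ‖T i‖ ^ 2 := by
    intro τ
    let K : Submodule ℂ (HN T ξ N) := (auxK T ξ N).comap (HN T ξ N).subtype
    have hKfin : Module.finrank ℂ K = Module.finrank ℂ (auxK T ξ N) :=
      (Submodule.comapSubtypeEquivOfLe (aux_K_le T ξ N)).finrank_eq
    have hKo : Module.finrank ℂ Kᗮ ≤ m * (N + n).choose n := by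
      have h1 := K.finrank_add_finrank_orthogonal
      have h2 := aux_finrank T ξ N
      rw [hξ] at h2
      omega
    have hkill : ∀ x ∈ K, auxC (HN T ξ N) (bsExpr hd T P τ N) x = 0 := by
      intro x hx
      have h1 : P N (x : H) = x := (hP N).2.2 _ x.2
      have h2 : ∀ j, P N (T j x) = T j x := fun j => (hP N).2.2 _ (aux_K_map T hcomm ξ N j _ hx)
      rw [auxC_apply]
      have : bsExpr hd T P τ N (x : H) = 0 := by
        simp only [bsExpr, mul_apply_eq_comp, h1, _root_.sub_apply,
          one_apply_eq_self, h2, sub_self, map_zero]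
      rw [this, map_zero]
    have hnorm : ‖auxC (HN T ξ N) (bsExpr hd T P τ N)‖ ≤ ‖bsExpr hd T P τ N‖ :=
      aux_norm _ _
    have hb := hbd τ N
    have hch : (0 : ℝ) < ((N + n).choose n : ℝ) := by
      exact_mod_cast Nat.choose_pos (by omega)
    have e1 : N + (n + 1) - 1 = N + n := by omega
    have e2 : n + 1 - 1 = n := by omega
    rw [e1, e2] at hb
    calc ‖auxTr (HN T ξ N) (bsExpr hd T P τ N)‖
        ≤ Module.finrank ℂ Kᗮ * ‖auxC (HN T ξ N) (bsExpr hd T P τ N)‖ :=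
          aux_trace_le' _ K hkill
      _ ≤ ((m * (N + n).choose n : ℕ) : ℝ) *
          ((θ : ℝ) * (((N + n).choose n : ℝ))⁻¹ * ∏ i, ‖T i‖ ^ 2) := by
          gcongr
          exact hnorm.trans hb
      _ = m * θ * ∏ i, ‖T i‖ ^ 2 := by
          push_cast
          field_simp
  calc (auxTr (HN T ξ N) (detOp T)).re ≤ ‖auxTr (HN T ξ N) (detOp T)‖ := Complex.re_le_norm _
    _ ≤ ∑ τ : Equiv.Perm (Fin (n+1)), (m * θ * ∏ i, ‖T i‖ ^ 2 : ℝ) := by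
        rw [htr]
        refine (norm_sum_le _ _).trans (Finset.sum_le_sum fun τ _ => ?_)
        refine le_trans (le_of_eq ?_) (hone τ)
        rcases Int.units_eq_one_or (Equiv.Perm.sign τ) with h | h <;> simp [h]
    _ = _ := by
        rw [Finset.sum_const, Finset.card_univ, Fintype.card_perm, Fintype.card_fin, nsmul_eq_mul]
        ring
end
end

section
/- Let S = (S_1, …, S_d) be the d-tuple of multiplication operators by the coordinate functions on the Hardy space H²(𝔹_d) of the unit Euclidean ball, i.e. the commuting joint weighted shift on ℓ²(ℕ^d) acting on the orthonormal basis {e_α : α ∈ ℕ^d} by S_i e_α = sqrt((α_i + 1)/(|α| + d)) e_{α+ε_i}, where |α| = α_1 + … + α_d and ε_i is the i-th standard unit multi-index. Then the determinant operator dEt([[S*, S]]) is diagonal with dEt([[S*, S]]) e_α = (d−1)! · ( 1/(|α|+d)^{d−1} − |α|/(|α|+d−1)^{d} ) e_α; in particular dEt([[S*, S]]) is non-negative definite, and trace(dEt([[S*, S]])) = 1. -/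
open ContinuousLinearMap MeasureTheory
open scoped ENNReal NNReal ComplexOrder

noncomputable section

variable {H H₁ H₂ K : Type*}
variable [NormedAddCommGroup H] [InnerProductSpace ℂ H] [CompleteSpace H]
variable [NormedAddCommGroup H₁] [InnerProductSpace ℂ H₁] [CompleteSpace H₁]
variable [NormedAddCommGroup H₂] [InnerProductSpace ℂ H₂] [CompleteSpace H₂]
variable [NormedAddCommGroup K] [InnerProductSpace ℂ K] [CompleteSpace K]

section alg
variable {d : ℕ} {R : Type*} [Ring R] [Algebra ℂ R]

/-- double antisymmetrization -/
def asum (F : Equiv.Perm (Fin d) → Equiv.Perm (Fin d) → R) : R :=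
  ∑ τ : Equiv.Perm (Fin d), ∑ η : Equiv.Perm (Fin d),
    ((Equiv.Perm.sign τ : ℤ) * (Equiv.Perm.sign η : ℤ)) • F τ η

lemma asum_sub (F G : Equiv.Perm (Fin d) → Equiv.Perm (Fin d) → R) :
    asum (fun τ η => F τ η - G τ η) = asum F - asum G := by
  simp only [asum, smul_sub, Finset.sum_sub_distrib]

lemma asum_smul (c : ℂ) (F : Equiv.Perm (Fin d) → Equiv.Perm (Fin d) → R) :
    asum (fun τ η => c • F τ η) = c • asum F := by
  simp only [asum, Finset.smul_sum]
  refine Finset.sum_congr rfl fun τ _ => Finset.sum_congr rfl fun η _ => ?_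
  rw [smul_comm]

lemma asum_swap {p l : Fin d} (h : p ≠ l) (F : Equiv.Perm (Fin d) → Equiv.Perm (Fin d) → R) :
    asum (fun τ η => F (τ * Equiv.swap p l) η) = - asum F := by
  unfold asum
  rw [← Equiv.sum_comp (Equiv.mulRight (Equiv.swap p l)), ← Finset.sum_neg_distrib]
  refine Finset.sum_congr rfl fun τ _ => ?_
  rw [← Finset.sum_neg_distrib]
  refine Finset.sum_congr rfl fun η _ => ?_
  simp [mul_assoc, Equiv.Perm.sign_mul, Equiv.Perm.sign_swap h]

lemma asum_zero {p l : Fin d} (h : p ≠ l) (F : Equiv.Perm (Fin d) → Equiv.Perm (Fin d) → R)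
    (hF : ∀ τ η, F (τ * Equiv.swap p l) η = F τ η) : asum F = 0 := by
  have h1 := asum_swap h F
  simp only [hF] at h1
  have h2 : (2 : ℂ) • asum F = 0 := by
    rw [two_smul]
    nth_rewrite 1 [h1]
    simp
  have := congrArg (fun x => (2⁻¹ : ℂ) • x) h2
  simpa [smul_smul] using this

lemma asum_diag (F : Equiv.Perm (Fin d) → R) :
    asum (fun τ η => if τ = η then F τ else 0) = ∑ τ, F τ := by
  unfold asum
  refine Finset.sum_congr rfl fun τ _ => ?_
  rw [Finset.sum_eq_single τ]
  · simp [← Int.cast_mul, ← Units.val_mul]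
  · intro η _ hη
    simp [hη.symm]
  · simp

lemma sum_perm_apply (hd : 0 < d) (f : Fin d → R) (l : Fin d) :
    ∑ τ : Equiv.Perm (Fin d), f (τ l) = ((d - 1).factorial : ℂ) • ∑ i, f i := by
  have h1 : ∀ l', ∑ τ : Equiv.Perm (Fin d), f (τ l') = ∑ τ : Equiv.Perm (Fin d), f (τ l) := by
    intro l'
    rw [← Equiv.sum_comp (Equiv.mulRight (Equiv.swap l l'))]
    simp
  have h2 : (d : ℂ) • ∑ τ : Equiv.Perm (Fin d), f (τ l) = (d.factorial : ℂ) • ∑ i, f i := by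
    have : ∑ l', ∑ τ : Equiv.Perm (Fin d), f (τ l') = (d.factorial : ℂ) • ∑ i, f i := by
      rw [Finset.sum_comm]
      simp only [fun τ : Equiv.Perm (Fin d) => Equiv.sum_comp τ f]
      simp [Fintype.card_perm, Nat.cast_smul_eq_nsmul]
    rw [← this]
    simp [h1, Nat.cast_smul_eq_nsmul]
  have hd' : (d : ℂ) ≠ 0 := by exact_mod_cast hd.ne'
  have h3 : (d.factorial : ℂ) = d * (d - 1).factorial := by
    rw [← Nat.mul_factorial_pred hd.ne']; push_cast; rfl
  have := congrArg (fun x => (d⁻¹ : ℂ) • x) h2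
  simpa [smul_smul, hd', h3] using this

/-- product of the first p factors -/
def pre (C : Fin d → Fin d → R) (p : ℕ) (τ η : Equiv.Perm (Fin d)) : R :=
  ((List.ofFn fun k => C (τ k) (η k)).take p).prod

lemma pre_succ (C : Fin d → Fin d → R) (p : Fin d) (τ η : Equiv.Perm (Fin d)) :
    pre C (p + 1) τ η = pre C p τ η * C (τ p) (η p) := by
  unfold pre
  rw [List.prod_take_succ _ _ (by simp)]
  simp

lemma pre_full (C : Fin d → Fin d → R) (τ η : Equiv.Perm (Fin d)) :
    pre C d τ η = (List.ofFn fun k => C (τ k) (η k)).prod := by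
  unfold pre
  rw [List.take_of_length_le (by simp)]

lemma pre_swap (C : Fin d → Fin d → R) (p l : Fin d) (h : p < l) (τ η : Equiv.Perm (Fin d)) :
    pre C p (τ * Equiv.swap p l) η = pre C p τ η := by
  unfold pre
  congr 1
  apply List.ext_getElem
  · simp
  · intro k h1 h2
    simp only [List.length_take, List.length_ofFn, lt_inf_iff] at h1
    have ha : (⟨k, h1.2⟩ : Fin d) ≠ p := by
      intro hh; have := congrArg Fin.val hh; simp at this; omega
    have hb : (⟨k, h1.2⟩ : Fin d) ≠ l := by
      intro hh; have := congrArg Fin.val hh; simp at this; have : (p : ℕ) < l := h; omega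
    simp [Equiv.swap_apply_of_ne_of_ne ha hb]

/-- entries -/
def Cent (X D : Fin d → R) (u v : ℂ) (i j : Fin d) : R :=
  u • (if i = j then 1 else 0) - v • (X i * D j)

open Classical in
/-- terms with one surviving pair -/
def Tterm (X D : Fin d → R) (u v : ℂ) (l : Fin d) (p : ℕ) (τ η : Equiv.Perm (Fin d)) : R :=
  if (∀ k : Fin d, p ≤ k → k ≠ l → τ k = η k) then
    pre (Cent X D u v) p τ η * (X (τ l) * D (η l)) else 0

lemma asum_T_step (X D : Fin d → R) (hX : ∀ i k, X i * X k = X k * X i)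
  (hDX : ∀ i j, D j * X i = X i * D j + if i = j then 1 else 0) (u v : ℂ)
    (l p : Fin d) (hpl : p < l) :
    asum (Tterm X D u v l (p + 1)) = (u + v) • asum (Tterm X D u v l p) := by
  classical
  set Q : Equiv.Perm (Fin d) → Equiv.Perm (Fin d) → Prop := fun τ η =>
    ∀ k : Fin d, (p : ℕ) + 1 ≤ k → k ≠ l → τ k = η k with hQ
  have hQs : ∀ τ η, Q (τ * Equiv.swap p l) η ↔ Q τ η := by
    intro τ η
    simp only [hQ]
    refine forall_congr' fun k => ?_
    refine forall_congr' fun hk => ?_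
    refine forall_congr' fun hkl => ?_
    have : k ≠ p := by rintro rfl; omega
    simp [Equiv.swap_apply_of_ne_of_ne this hkl]
  set F2 : Equiv.Perm (Fin d) → Equiv.Perm (Fin d) → R := fun τ η =>
    if Q τ η then pre (Cent X D u v) p τ η * (X (τ p) * X (τ l) * (D (η p) * D (η l))) else 0
    with hF2
  have hQ0 : ∀ τ η, (∀ k : Fin d, (p : ℕ) ≤ k → k ≠ l → τ k = η k) ↔ (Q τ η ∧ τ p = η p) := by
    intro τ η
    constructor
    · intro h
      exact ⟨fun k hk hkl => h k (by omega) hkl, h p le_rfl hpl.ne⟩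
    · rintro ⟨h, h'⟩ k hk hkl
      by_cases hkp : k = p
      · subst hkp; exact h'
      · exact h k (by have : (k : ℕ) ≠ p := fun h => hkp (Fin.ext h)
                      omega) hkl
  have key : Tterm X D u v l (p + 1) = fun τ η =>
      u • Tterm X D u v l p τ η - (v • F2 τ η -
        (-v) • Tterm X D u v l p (τ * Equiv.swap p l) η) := by
    funext τ η
    simp only [Tterm, hF2, hQ0, hQs, pre_swap _ _ _ hpl]
    have : (∀ k : Fin d, (p : ℕ) + 1 ≤ k → k ≠ l → τ k = η k) ↔ Q τ η := Iff.rfl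
    simp only [this]
    by_cases hq : Q τ η
    · simp only [hq, if_true, true_and, pre_succ, Cent]
      have e : X (τ p) * D (η p) * (X (τ l) * D (η l)) =
          X (τ p) * X (τ l) * (D (η p) * D (η l)) +
            (if τ l = η p then X (τ p) * D (η l) else 0) := by
        have : X (τ p) * D (η p) * (X (τ l) * D (η l)) =
          X (τ p) * (D (η p) * X (τ l)) * D (η l) := by noncomm_ring
        rw [this, hDX]
        split_ifs <;> noncomm_ring
      simp only [mul_assoc, sub_mul, mul_sub, smul_mul_assoc, mul_smul_comm] at e ⊢
      rw [e]
      simp only [Equiv.Perm.mul_apply, Equiv.swap_apply_left, Equiv.swap_apply_right]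
      split_ifs <;> simp [mul_add]
    · simp [hq]
  rw [key, asum_sub, asum_smul, asum_sub, asum_smul, asum_smul, asum_swap hpl.ne,
    asum_zero hpl.ne F2]
  · simp [add_smul]
  · intro τ η
    simp only [hF2, hQs, pre_swap _ _ _ hpl]
    simp [hX (τ l) (τ p)]

lemma asum_T (X D : Fin d → R) (hX : ∀ i k, X i * X k = X k * X i)
  (hDX : ∀ i j, D j * X i = X i * D j + if i = j then 1 else 0) (u v : ℂ)
    (hd : 0 < d) (l : Fin d) (p : ℕ) (hp : p ≤ l) :
    asum (Tterm X D u v l p) =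
      (u + v) ^ p • (((d - 1).factorial : ℂ) • ∑ i, X i * D i) := by
  induction p with
  | zero =>
    classical
    have : Tterm X D u v l 0 = fun τ η => if τ = η then X (τ l) * D (τ l) else 0 := by
      funext τ η
      have hiff : (∀ k : Fin d, 0 ≤ (k : ℕ) → k ≠ l → τ k = η k) ↔ τ = η := by
        constructor
        · intro h
          have hne : ∀ k, k ≠ l → (η⁻¹ * τ) k = k := by
            intro k hk
            simp [h k (Nat.zero_le _) hk]
          have hl : (η⁻¹ * τ) l = l := by
            by_contra hh
            have := hne _ hh
            exact hh ((η⁻¹ * τ).injective this)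
          have : η⁻¹ * τ = 1 := by
            ext k
            by_cases hk : k = l
            · subst hk; rw [hl]; rfl
            · rw [hne k hk]; rfl
          exact (inv_mul_eq_one.mp this).symm
        · rintro rfl k _ _; rfl
      simp only [Tterm, hiff]
      split_ifs with h
      · subst h; simp [pre]
      · rfl
    rw [this, asum_diag, sum_perm_apply hd (fun i => X i * D i)]
    simp
  | succ p ih =>
    have := asum_T_step X D hX hDX u v l ⟨p, by omega⟩ (by
      show p < (l : ℕ); omega)
    simp only at this
    rw [this, ih (by omega), smul_smul, pow_succ']

open Classical in
/-- terms with no pair -/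
def Uterm (X D : Fin d → R) (u v : ℂ) (p : ℕ) (τ η : Equiv.Perm (Fin d)) : R :=
  if (∀ k : Fin d, p ≤ k → τ k = η k) then pre (Cent X D u v) p τ η else 0

lemma asum_U (X D : Fin d → R) (hX : ∀ i k, X i * X k = X k * X i)
  (hDX : ∀ i j, D j * X i = X i * D j + if i = j then 1 else 0) (u v : ℂ)
    (hd : 0 < d) (p : ℕ) (hp : p ≤ d) :
    asum (Uterm X D u v p) = (u ^ p * d.factorial) • (1 : R) -
      ((u + v) ^ p - u ^ p) • (((d - 1).factorial : ℂ) • ∑ i, X i * D i) := by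
  classical
  induction p with
  | zero =>
    have : Uterm X D u v 0 = fun τ η => if τ = η then (1 : R) else 0 := by
      funext τ η
      have : (∀ k : Fin d, 0 ≤ (k : ℕ) → τ k = η k) ↔ τ = η := by
        simp [Equiv.ext_iff]
      simp only [Uterm, this]
      simp [pre]
    rw [this, asum_diag]
    simp [Fintype.card_perm, Nat.cast_smul_eq_nsmul]
  | succ p ih =>
    set P : Fin d := ⟨p, by omega⟩ with hP
    have key : Uterm X D u v (p + 1) = fun τ η => u • Uterm X D u v p τ η -
        v • Tterm X D u v P p τ η := by
      funext τ η
      have h1 : (∀ k : Fin d, p + 1 ≤ (k : ℕ) → τ k = η k) ↔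
          (∀ k : Fin d, p ≤ (k : ℕ) → k ≠ P → τ k = η k) := by
        refine forall_congr' fun k => ?_
        have hk : k ≠ P ↔ (k : ℕ) ≠ p := by rw [Ne, Fin.ext_iff]
        rw [hk]
        constructor
        · intro h h2 h3
          exact h (by omega)
        · intro h h2
          exact h (by omega) (by omega)
      have h2 : (∀ k : Fin d, p ≤ (k : ℕ) → τ k = η k) ↔
          (∀ k : Fin d, p ≤ (k : ℕ) → k ≠ P → τ k = η k) ∧ τ P = η P := by
        constructor
        · intro h; exact ⟨fun k hk _ => h k hk, h P le_rfl⟩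
        · rintro ⟨h, h'⟩ k hk
          by_cases hkp : k = P
          · rw [hkp]; exact h'
          · exact h k hk hkp
      have h3 := pre_succ (Cent X D u v) P τ η
      simp only [hP] at h3
      simp only [Uterm, Tterm, h1, h2, h3]
      by_cases hq : (∀ k : Fin d, p ≤ (k : ℕ) → k ≠ P → τ k = η k)
      · have h4 : ((∀ k : Fin d, p ≤ (k : ℕ) → k ≠ P → τ k = η k) ∧ τ P = η P) ↔ τ P = η P :=
          and_iff_right hq
        simp only [if_pos hq, h4, Cent, ← hP]
        split_ifs <;> simp [mul_sub]
      · simp [hq]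
    rw [key, asum_sub, asum_smul, asum_smul, ih (by omega), asum_T X D hX hDX u v hd P p le_rfl]
    generalize (((d - 1).factorial : ℂ) • ∑ i, X i * D i) = N
    rw [smul_sub, smul_smul, smul_smul, smul_smul, sub_sub, ← add_smul]
    congr 2 <;> ring

lemma asum_main (X D : Fin d → R) (hX : ∀ i k, X i * X k = X k * X i)
  (hDX : ∀ i j, D j * X i = X i * D j + if i = j then 1 else 0) (u v : ℂ)
    (hd : 0 < d) :
    asum (fun τ η => (List.ofFn fun k => Cent X D u v (τ k) (η k)).prod) =
      (u ^ d * d.factorial) • (1 : R) -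
      ((u + v) ^ d - u ^ d) • (((d - 1).factorial : ℂ) • ∑ i, X i * D i) := by
  rw [← asum_U X D hX hDX u v hd d le_rfl]
  congr 1
  funext τ η
  rw [Uterm, if_pos, pre_full]
  intro k hk
  omega

end alg

section fock
variable {d : ℕ}

/-- creation operator -/
def crea (i : Fin d) : Module.End ℂ ((Fin d → ℕ) →₀ ℂ) :=
  Finsupp.linearCombination ℂ (fun β : Fin d → ℕ =>
    ((Real.sqrt ((β i : ℝ) + 1) : ℝ) : ℂ) • Finsupp.single (β + Pi.single i 1) (1 : ℂ))

/-- annihilation operator -/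
def anni (i : Fin d) : Module.End ℂ ((Fin d → ℕ) →₀ ℂ) :=
  Finsupp.linearCombination ℂ (fun β : Fin d → ℕ =>
    ((Real.sqrt (β i : ℝ) : ℝ) : ℂ) • Finsupp.single (β - Pi.single i 1) (1 : ℂ))

lemma crea_single (i : Fin d) (β : Fin d → ℕ) : crea i (Finsupp.single β 1) =
    ((Real.sqrt ((β i : ℝ) + 1) : ℝ) : ℂ) • Finsupp.single (β + Pi.single i 1) (1 : ℂ) := by
  simp only [crea, Finsupp.linearCombination_single, one_smul]

lemma anni_single (i : Fin d) (β : Fin d → ℕ) : anni i (Finsupp.single β 1) =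
    ((Real.sqrt (β i : ℝ) : ℝ) : ℂ) • Finsupp.single (β - Pi.single i 1) (1 : ℂ) := by
  simp only [anni, Finsupp.linearCombination_single, one_smul]

lemma end_ext {A B : Module.End ℂ ((Fin d → ℕ) →₀ ℂ)}
    (h : ∀ β, A (Finsupp.single β 1) = B (Finsupp.single β 1)) : A = B := by
  apply Finsupp.lhom_ext'
  intro β
  apply LinearMap.ext_ring
  simpa using h β

lemma crea_comm (i k : Fin d) : crea i * crea k = crea k * crea i := by
  by_cases h : i = k
  · subst h; rfl
  apply end_ext
  intro β
  simp only [Module.End.mul_apply, crea_single, map_smul, smul_smul]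
  have h' : k ≠ i := fun e => h e.symm
  rw [add_right_comm]
  congr 1
  simp [h, h', mul_comm]

lemma anni_crea (i j : Fin d) : anni j * crea i = crea i * anni j + if i = j then 1 else 0 := by
  apply end_ext
  intro β
  simp only [Module.End.mul_apply, LinearMap.add_apply, crea_single, anni_single, map_smul,
    smul_smul]
  by_cases h : i = j
  · subst h
    simp only [if_true, Module.End.one_apply]
    have e1 : β + Pi.single i 1 - Pi.single i 1 = β := by simp
    rw [e1]
    have e2 : Real.sqrt ((β i : ℝ) + 1) * Real.sqrt ((β i : ℝ) + 1) = β i + 1 :=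
      Real.mul_self_sqrt (by positivity)
    by_cases h0 : β i = 0
    · simp [h0]
    · have e3 : β - Pi.single i 1 + Pi.single i 1 = β := by
        funext k
        by_cases hk : k = i
        · subst hk; simp; omega
        · simp [hk]
      have e4 : (((β - Pi.single i 1 : Fin d → ℕ) i : ℕ) : ℝ) + 1 = β i := by
        have : (β - Pi.single i 1 : Fin d → ℕ) i + 1 = β i := by simp; omega
        exact_mod_cast this
      rw [e3, e4]
      have e5 : Real.sqrt (β i : ℝ) * Real.sqrt (β i : ℝ) = β i :=
        Real.mul_self_sqrt (by positivity)
      have e6 : (((β + Pi.single i 1 : Fin d → ℕ) i : ℕ) : ℝ) = β i + 1 := by simp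
      rw [e6, ← Complex.ofReal_mul, ← Complex.ofReal_mul, e2, e5]
      nth_rewrite 3 [← one_smul ℂ (Finsupp.single β (1 : ℂ))]
      rw [← add_smul]
      simp
  · have h' : j ≠ i := fun e => h e.symm
    simp only [if_neg h, LinearMap.zero_apply, add_zero]
    by_cases h0 : β j = 0
    · simp [h0, h']
    · have e1 : β + Pi.single i 1 - Pi.single j 1 = β - Pi.single j 1 + Pi.single i 1 := by
        funext k
        by_cases hk : k = i
        · subst hk; simp [h]
        · simp [hk]
      rw [e1]
      congr 1
      simp [h, h', mul_comm]

/-- the homogeneous part -/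
def Vn (d n : ℕ) : Submodule ℂ ((Fin d → ℕ) →₀ ℂ) :=
  Submodule.span ℂ {x | ∃ β : Fin d → ℕ, ∑ j, β j = n ∧ x = Finsupp.single β 1}

lemma sum_add_single (β : Fin d → ℕ) (i : Fin d) :
    ∑ j, (β + Pi.single i 1 : Fin d → ℕ) j = ∑ j, β j + 1 := by
  simp [Finset.sum_add_distrib]

lemma sub_add_single (β : Fin d → ℕ) (i : Fin d) (h : β i ≠ 0) :
    β - Pi.single i 1 + Pi.single i 1 = β := by
  funext k
  by_cases hk : k = i
  · subst hk; simp; omega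
  · simp [hk]

lemma crea_mem (i : Fin d) (n : ℕ) (x : (Fin d → ℕ) →₀ ℂ) (hx : x ∈ Vn d n) :
    crea i x ∈ Vn d (n + 1) := by
  have : Vn d n ≤ (Vn d (n + 1)).comap (crea i) := by
    rw [Vn, Submodule.span_le]
    rintro _ ⟨β, hβ, rfl⟩
    simp only [Submodule.comap_coe, Set.mem_preimage, crea_single, SetLike.mem_coe]
    apply Submodule.smul_mem
    apply Submodule.subset_span
    exact ⟨_, by rw [sum_add_single, hβ], rfl⟩
  exact this hx

lemma anni_mem (i : Fin d) (n : ℕ) (x : (Fin d → ℕ) →₀ ℂ) (hx : x ∈ Vn d (n + 1)) :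
    anni i x ∈ Vn d n := by
  have : Vn d (n + 1) ≤ (Vn d n).comap (anni i) := by
    conv_lhs => rw [Vn]
    rw [Submodule.span_le]
    rintro _ ⟨β, hβ, rfl⟩
    simp only [Submodule.comap_coe, Set.mem_preimage, anni_single, SetLike.mem_coe]
    by_cases h0 : β i = 0
    · simp [h0]
    apply Submodule.smul_mem
    apply Submodule.subset_span
    refine ⟨_, ?_, rfl⟩
    have := sum_add_single (β - Pi.single i 1) i
    rw [sub_add_single β i h0] at this
    omega
  exact this hx

lemma anni_zero (i : Fin d) (x : (Fin d → ℕ) →₀ ℂ) (hx : x ∈ Vn d 0) :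
    anni i x = 0 := by
  have : Vn d 0 ≤ LinearMap.ker (anni i) := by
    rw [Vn, Submodule.span_le]
    rintro _ ⟨β, hβ, rfl⟩
    have h0 : β i = 0 := by
      have := Finset.sum_eq_zero_iff.mp hβ i (Finset.mem_univ _)
      exact this
    simp [anni_single, h0]
  exact this hx

lemma crea_anni_mem (i j : Fin d) (n : ℕ) (x : (Fin d → ℕ) →₀ ℂ) (hx : x ∈ Vn d n) :
    crea i (anni j x) ∈ Vn d n := by
  cases n with
  | zero => simp [anni_zero j x hx]
  | succ n => exact crea_mem i n _ (anni_mem j n x hx)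

lemma number_single (α : Fin d → ℕ) :
    (∑ i, crea i * anni i : Module.End ℂ ((Fin d → ℕ) →₀ ℂ)) (Finsupp.single α 1) =
      ((∑ j, α j : ℕ) : ℂ) • Finsupp.single α 1 := by
  rw [LinearMap.sum_apply]
  push_cast
  rw [Finset.sum_smul]
  refine Finset.sum_congr rfl fun i _ => ?_
  simp only [Module.End.mul_apply, anni_single, map_smul, crea_single, smul_smul]
  by_cases h0 : α i = 0
  · simp [h0]
  · rw [sub_add_single α i h0]
    have e4 : (((α - Pi.single i 1 : Fin d → ℕ) i : ℕ) : ℝ) + 1 = α i := by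
      have : (α - Pi.single i 1 : Fin d → ℕ) i + 1 = α i := by simp; omega
      exact_mod_cast this
    have e5 : Real.sqrt (α i : ℝ) * Real.sqrt (α i : ℝ) = α i :=
      Real.mul_self_sqrt (by positivity)
    rw [e4, ← Complex.ofReal_mul, e5]
    simp

end fock

section shift
variable {d : ℕ} (b : HilbertBasis (Fin d → ℕ) ℂ H) (S : Fin d → H →L[ℂ] H)

lemma adj_basis
    (hS : ∀ (i : Fin d) (α : Fin d → ℕ),
      S i (b α) = (Real.sqrt (((α i : ℝ) + 1) / ((∑ j, (α j : ℝ)) + d)) : ℂ) •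
        b (α + Pi.single i 1))
    (i : Fin d) (β : Fin d → ℕ) : adjoint (S i) (b β) =
    ((Real.sqrt (β i : ℝ) / Real.sqrt ((∑ j, (β j : ℝ)) + d - 1) : ℝ) : ℂ) •
      b (β - Pi.single i 1) := by
  classical
  have hb := b.orthonormal
  rw [orthonormal_iff_ite] at hb
  apply b.repr.injective
  ext γ
  rw [b.repr_apply_apply, b.repr_apply_apply, ContinuousLinearMap.adjoint_inner_right, hS,
    inner_smul_left, inner_smul_right, hb, hb]
  by_cases h : γ + Pi.single i 1 = β
  · subst h
    have e : γ + Pi.single i 1 - Pi.single i 1 = γ := by simp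
    have e2 : (∑ j, (((γ + Pi.single i 1 : Fin d → ℕ) j : ℕ) : ℝ)) = ∑ j, (γ j : ℝ) + 1 := by
      have := sum_add_single γ i
      exact_mod_cast this
    have e3 : (((γ + Pi.single i 1 : Fin d → ℕ) i : ℕ) : ℝ) = γ i + 1 := by simp
    rw [e, e2, e3, Real.sqrt_div (by positivity)]
    have e4 : ∑ j, (γ j : ℝ) + 1 + d - 1 = ∑ j, (γ j : ℝ) + d := by ring
    rw [e4]
    simp
  · rw [if_neg h]
    by_cases h0 : β i = 0
    · simp [h0]
    · rw [if_neg]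
      · simp
      · rintro rfl
        exact h (sub_add_single β i h0)

/-- the intertwiner -/
def Phi (b : HilbertBasis (Fin d → ℕ) ℂ H) : ((Fin d → ℕ) →₀ ℂ) →ₗ[ℂ] H :=
  Finsupp.linearCombination ℂ (fun β => b β)

lemma Phi_single (β : Fin d → ℕ) : Phi b (Finsupp.single β 1) = b β := by
  simp [Phi]

lemma S_Phi
    (hS : ∀ (i : Fin d) (α : Fin d → ℕ),
      S i (b α) = (Real.sqrt (((α i : ℝ) + 1) / ((∑ j, (α j : ℝ)) + d)) : ℂ) •
        b (α + Pi.single i 1))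
    (i : Fin d) (n : ℕ) (x : (Fin d → ℕ) →₀ ℂ) (hx : x ∈ Vn d n) :
    S i (Phi b x) = (((Real.sqrt ((n : ℝ) + d))⁻¹ : ℝ) : ℂ) • Phi b (crea i x) := by
  have : Vn d n ≤ LinearMap.eqLocus ((S i).toLinearMap ∘ₗ Phi b)
      ((((Real.sqrt ((n : ℝ) + d))⁻¹ : ℝ) : ℂ) • (Phi b ∘ₗ crea i)) := by
    rw [Vn, Submodule.span_le]
    rintro _ ⟨β, hβ, rfl⟩
    have hβ' : ∑ j, (β j : ℝ) = n := by exact_mod_cast hβ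
    simp only [SetLike.mem_coe, LinearMap.mem_eqLocus, LinearMap.comp_apply, LinearMap.smul_apply,
      crea_single, map_smul, Phi_single, ContinuousLinearMap.coe_coe, hS, smul_smul, hβ']
    rw [Real.sqrt_div (by positivity)]
    congr 1
    push_cast
    ring
  exact this hx

lemma Sadj_Phi
    (hS : ∀ (i : Fin d) (α : Fin d → ℕ),
      S i (b α) = (Real.sqrt (((α i : ℝ) + 1) / ((∑ j, (α j : ℝ)) + d)) : ℂ) •
        b (α + Pi.single i 1))
    (i : Fin d) (n : ℕ) (x : (Fin d → ℕ) →₀ ℂ) (hx : x ∈ Vn d n) :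
    adjoint (S i) (Phi b x) =
      (((Real.sqrt ((n : ℝ) + d - 1))⁻¹ : ℝ) : ℂ) • Phi b (anni i x) := by
  have : Vn d n ≤ LinearMap.eqLocus ((adjoint (S i)).toLinearMap ∘ₗ Phi b)
      ((((Real.sqrt ((n : ℝ) + d - 1))⁻¹ : ℝ) : ℂ) • (Phi b ∘ₗ anni i)) := by
    rw [Vn, Submodule.span_le]
    rintro _ ⟨β, hβ, rfl⟩
    have hβ' : ∑ j, (β j : ℝ) = n := by exact_mod_cast hβ
    simp only [SetLike.mem_coe, LinearMap.mem_eqLocus, LinearMap.comp_apply, LinearMap.smul_apply,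
      anni_single, map_smul, Phi_single, ContinuousLinearMap.coe_coe, adj_basis b S hS, smul_smul,
      hβ']
    congr 1
    push_cast
    ring
  exact this hx

/-- first scalar -/
def uu (d n : ℕ) : ℝ := ((n : ℝ) + d)⁻¹
/-- second scalar -/
def ww (d n : ℕ) : ℝ := ((n : ℝ) + d - 1)⁻¹

lemma cmt_Phi
    (hS : ∀ (i : Fin d) (α : Fin d → ℕ),
      S i (b α) = (Real.sqrt (((α i : ℝ) + 1) / ((∑ j, (α j : ℝ)) + d)) : ℂ) •
        b (α + Pi.single i 1))
    (hd : 0 < d) (i j : Fin d) (n : ℕ) (x : (Fin d → ℕ) →₀ ℂ) (hx : x ∈ Vn d n) :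
    cmt (adjoint (S j)) (S i) (Phi b x) =
      Phi b (Cent crea anni (uu d n : ℂ) ((ww d n : ℂ) - (uu d n : ℂ)) i j x) := by
  have h1 : adjoint (S j) (S i (Phi b x)) = (uu d n : ℂ) • Phi b (anni j (crea i x)) := by
    rw [S_Phi b S hS i n x hx, map_smul, Sadj_Phi b S hS j (n + 1) _ (crea_mem i n x hx), smul_smul]
    congr 1
    have e : ((n + 1 : ℕ) : ℝ) + d - 1 = n + d := by push_cast; ring
    rw [e, ← Complex.ofReal_mul, ← mul_inv, Real.mul_self_sqrt (by positivity), uu]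
  have h2 : S i (adjoint (S j) (Phi b x)) = (ww d n : ℂ) • Phi b (crea i (anni j x)) := by
    cases n with
    | zero =>
      rw [Sadj_Phi b S hS j 0 x hx, anni_zero j x hx]
      simp
    | succ n =>
      rw [Sadj_Phi b S hS j _ x hx, map_smul, S_Phi b S hS i n _ (anni_mem j n x hx), smul_smul]
      congr 1
      have e : ((n + 1 : ℕ) : ℝ) + d - 1 = n + d := by push_cast; ring
      rw [ww, e, ← Complex.ofReal_mul, ← mul_inv, Real.mul_self_sqrt (by positivity)]
  have h3 : anni j (crea i x) = crea i (anni j x) + (if i = j then (1 : Module.End ℂ _) else 0) x := by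
    have := congrArg (fun A => A x) (anni_crea i j)
    simpa using this
  simp only [cmt, ContinuousLinearMap.sub_apply, ContinuousLinearMap.mul_apply, h1, h2, h3, Cent,
    LinearMap.sub_apply, LinearMap.smul_apply, Module.End.mul_apply, map_sub, map_smul, map_add,
    smul_add, sub_smul]
  abel

lemma Cent_mem (u v : ℂ) (i j : Fin d) (n : ℕ) (x : (Fin d → ℕ) →₀ ℂ) (hx : x ∈ Vn d n) :
    Cent crea anni u v i j x ∈ Vn d n := by
  simp only [Cent, LinearMap.sub_apply, LinearMap.smul_apply, Module.End.mul_apply]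
  refine Submodule.sub_mem _ (Submodule.smul_mem _ _ ?_)
    (Submodule.smul_mem _ _ (crea_anni_mem i j n x hx))
  split_ifs
  · exact hx
  · simp

lemma list_Phi
    (hS : ∀ (i : Fin d) (α : Fin d → ℕ),
      S i (b α) = (Real.sqrt (((α i : ℝ) + 1) / ((∑ j, (α j : ℝ)) + d)) : ℂ) •
        b (α + Pi.single i 1))
    (hd : 0 < d) (n : ℕ) (L : List (Fin d × Fin d)) (x : (Fin d → ℕ) →₀ ℂ)
    (hx : x ∈ Vn d n) :
    (L.map fun q => cmt (adjoint (S q.2)) (S q.1)).prod (Phi b x) =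
      Phi b ((L.map fun q =>
        Cent crea anni (uu d n : ℂ) ((ww d n : ℂ) - (uu d n : ℂ)) q.1 q.2).prod x) ∧
    (L.map fun q =>
        Cent crea anni (uu d n : ℂ) ((ww d n : ℂ) - (uu d n : ℂ)) q.1 q.2).prod x ∈ Vn d n := by
  induction L with
  | nil => simpa using hx
  | cons q L ih =>
    simp only [List.map_cons, List.prod_cons, ContinuousLinearMap.mul_apply, Module.End.mul_apply]
    rw [ih.1, cmt_Phi b S hS hd _ _ n _ ih.2]
    exact ⟨rfl, Cent_mem _ _ _ _ n _ ih.2⟩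

lemma detOp_basis
    (hS : ∀ (i : Fin d) (α : Fin d → ℕ),
      S i (b α) = (Real.sqrt (((α i : ℝ) + 1) / ((∑ j, (α j : ℝ)) + d)) : ℂ) •
        b (α + Pi.single i 1))
    (hd : 0 < d) (α : Fin d → ℕ) : detOp S (b α) =
      ((((d - 1).factorial : ℝ) *
        ((((∑ j, (α j : ℝ)) + d) ^ (d - 1))⁻¹ -
          (∑ j, (α j : ℝ)) * (((∑ j, (α j : ℝ)) + d - 1) ^ d)⁻¹) : ℝ) : ℂ) • b α := by
  set n : ℕ := ∑ j, α j with hn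
  have hn' : ∑ j, (α j : ℝ) = n := by rw [hn]; push_cast; rfl
  have hmem : Finsupp.single α (1 : ℂ) ∈ Vn d n := Submodule.subset_span ⟨α, rfl, rfl⟩
  have h1 : detOp S = asum (fun τ η =>
      (List.ofFn fun k => cmt (adjoint (S (η k))) (S (τ k))).prod) := by
    unfold detOp asum
    rw [Finset.sum_comm]
    refine Finset.sum_congr rfl fun τ _ => ?_
    rw [← Equiv.sum_comp (Equiv.mulRight τ)
      (fun η => ((Equiv.Perm.sign τ : ℤ) * (Equiv.Perm.sign η : ℤ)) •
        (List.ofFn fun k => cmt (adjoint (S (η k))) (S (τ k))).prod)]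
    refine Finset.sum_congr rfl fun σ _ => ?_
    congr 1
    simp only [Equiv.coe_mulRight, Equiv.Perm.sign_mul]
    rw [← Units.val_mul, mul_comm, mul_assoc, Int.units_mul_self, mul_one]
  have h2 : asum (fun τ η =>
      (List.ofFn fun k => cmt (adjoint (S (η k))) (S (τ k))).prod) (Phi b (Finsupp.single α 1)) =
      Phi b (asum (fun τ η => (List.ofFn fun k =>
        Cent crea anni (uu d n : ℂ) ((ww d n : ℂ) - (uu d n : ℂ)) (τ k) (η k)).prod)
          (Finsupp.single α 1)) := by
    simp only [asum, ContinuousLinearMap.sum_apply, LinearMap.sum_apply, map_sum]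
    refine Finset.sum_congr rfl fun τ _ => Finset.sum_congr rfl fun η _ => ?_
    have := (list_Phi b S hS hd n (List.ofFn fun k => (τ k, η k)) _ hmem).1
    simp only [List.map_ofFn, Function.comp_def] at this
    rw [ContinuousLinearMap.smul_apply, LinearMap.smul_apply, map_zsmul, this]
  rw [h1, ← Phi_single b α, h2, asum_main crea anni crea_comm anni_crea _ _ hd]
  simp only [LinearMap.sub_apply, LinearMap.smul_apply, number_single, map_sub, map_smul,
    Module.End.one_apply, Phi_single, smul_smul, ← sub_smul]
  congr 1
  rw [hn', ← hn]
  have hfac : (d.factorial : ℝ) = d * (d - 1).factorial := by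
    rw [← Nat.mul_factorial_pred hd.ne']; push_cast; rfl
  have hreal : uu d n ^ d * (d.factorial : ℝ) -
      ((uu d n + (ww d n - uu d n)) ^ d - uu d n ^ d) * ((d - 1).factorial * n) =
      ((d - 1).factorial : ℝ) * ((((n : ℝ) + d) ^ (d - 1))⁻¹ - n * (((n : ℝ) + d - 1) ^ d)⁻¹) := by
    have e1 : uu d n + (ww d n - uu d n) = ww d n := by ring
    have hpos : (n : ℝ) + d ≠ 0 := by positivity
    have e2 : (((n : ℝ) + d) ^ (d - 1))⁻¹ = (n + d) * uu d n ^ d := by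
      obtain ⟨m, rfl⟩ : ∃ m, d = m + 1 := ⟨d - 1, by omega⟩
      simp only [uu, Nat.add_sub_cancel, pow_succ, inv_pow]
      field_simp
    rw [e1, e2, hfac, ww, inv_pow]
    ring
  rw [← hreal]
  push_cast
  ring

end shift

section trace

/-- the eigenvalue -/
def lam (d n : ℕ) : ℝ := ((d - 1).factorial : ℝ) *
  ((((n : ℝ) + d) ^ (d - 1))⁻¹ - n * (((n : ℝ) + d - 1) ^ d)⁻¹)

lemma lam_nonneg (d : ℕ) (hd : 0 < d) (n : ℕ) : 0 ≤ lam d n := by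
  obtain ⟨k, rfl⟩ : ∃ k, d = k + 1 := ⟨d - 1, by omega⟩
  unfold lam
  apply mul_nonneg (by positivity)
  rw [sub_nonneg]
  rcases Nat.eq_zero_or_pos n with rfl | hn
  · simp; positivity
  simp only [Nat.add_sub_cancel]
  have hn' : (1 : ℝ) ≤ n := by exact_mod_cast hn
  have e : (n : ℝ) + ((k + 1 : ℕ) : ℝ) - 1 = n + k := by push_cast; ring
  have e' : (n : ℝ) + ((k + 1 : ℕ) : ℝ) = n + k + 1 := by push_cast; ring
  rw [e, e']
  set m : ℝ := n + k with hm
  have hm1 : 1 ≤ m := by have : (0 : ℝ) ≤ k := by positivity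
                         linarith
  have hkm : (n : ℝ) ≤ m := by have : (0 : ℝ) ≤ k := by positivity
                               linarith
  have hb := one_add_mul_le_pow (a := -(1 / (m + 1))) (by
    have : 1 / (m + 1) ≤ 1 := by rw [div_le_one (by linarith)]; linarith
    linarith) k
  have e1 : 1 + -(1 / (m + 1)) = m / (m + 1) := by field_simp; ring
  have e2 : 1 + (k : ℝ) * -(1 / (m + 1)) = (n + 1) / (m + 1) := by
    field_simp; rw [hm]; ring
  rw [e1, e2, div_pow, div_le_div_iff₀ (by linarith) (by positivity)] at hb
  rw [← div_eq_mul_inv, ← one_div, div_le_div_iff₀ (by positivity) (by positivity)]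
  have h3 : (n : ℝ) * (m + 1) ≤ m * (n + 1) := by nlinarith
  have h4 : (0 : ℝ) < (m + 1) ^ k := by positivity
  have h5 : (n * (m + 1) ^ k) * (m + 1) ≤ m ^ (k + 1) * (m + 1) := by
    calc (n * (m + 1) ^ k) * (m + 1) = (n * (m + 1)) * (m + 1) ^ k := by ring
      _ ≤ (m * (n + 1)) * (m + 1) ^ k := by gcongr
      _ = m * ((n + 1) * (m + 1) ^ k) := by ring
      _ ≤ m * (m ^ k * (m + 1)) := by gcongr
      _ = m ^ (k + 1) * (m + 1) := by ring
  have := le_of_mul_le_mul_right h5 (by linarith)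
  linarith

lemma partial_sum (k N : ℕ) :
    ∑ n ∈ Finset.range (N + 1), (((n + k).choose k : ℕ) : ℝ) * lam (k + 1) n =
      ∏ i ∈ Finset.range k, (((N : ℝ) + 1 + i) / (N + k + 1)) := by
  have hA : ∀ n : ℕ, (((n + k).choose k : ℕ) : ℝ) * (k.factorial : ℝ) =
      ∏ i ∈ Finset.range k, ((n : ℝ) + 1 + i) := by
    intro n
    have h := Nat.ascFactorial_eq_factorial_mul_choose n k
    have h2 := Nat.ascFactorial_eq_prod_range (n + 1) k
    rw [mul_comm, ← Nat.cast_mul, ← h, h2]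
    push_cast
    rfl
  have hlam : ∀ n : ℕ, (((n + k).choose k : ℕ) : ℝ) * lam (k + 1) n =
      (∏ i ∈ Finset.range k, ((n : ℝ) + 1 + i)) *
        ((((n : ℝ) + k + 1) ^ k)⁻¹ - n * (((n : ℝ) + k) ^ (k + 1))⁻¹) := by
    intro n
    rw [← hA, lam]
    have e : (n : ℝ) + ((k + 1 : ℕ) : ℝ) - 1 = n + k := by push_cast; ring
    have e' : (n : ℝ) + ((k + 1 : ℕ) : ℝ) = n + k + 1 := by push_cast; ring
    rw [e, e', Nat.add_sub_cancel]
    ring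
  have hprod : ∀ n : ℕ, ∏ i ∈ Finset.range k, (((n : ℝ) + 1 + i) / (n + k + 1)) =
      (∏ i ∈ Finset.range k, ((n : ℝ) + 1 + i)) * (((n : ℝ) + k + 1) ^ k)⁻¹ := by
    intro n
    rw [Finset.prod_div_distrib]
    simp [div_eq_mul_inv]
  rw [hprod]
  induction N with
  | zero => simp [hlam]
  | succ N ih =>
    rw [Finset.sum_range_succ, ih, hlam]
    have key : (∏ i ∈ Finset.range k, ((N : ℝ) + 1 + i)) * (N + 1 + k) =
        (∏ i ∈ Finset.range k, (((N + 1 : ℕ) : ℝ) + 1 + i)) * (N + 1) := by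
      have h1 := Finset.prod_range_succ (fun i : ℕ => (N : ℝ) + 1 + i) k
      have h2 := Finset.prod_range_succ' (fun i : ℕ => (N : ℝ) + 1 + i) k
      rw [h1] at h2
      rw [h2]
      simp only [Nat.cast_zero, add_zero]
      congr 1
      refine Finset.prod_congr rfl fun i _ => ?_
      push_cast
      ring
    set P := ∏ i ∈ Finset.range k, ((N : ℝ) + 1 + i)
    set Q := ∏ i ∈ Finset.range k, (((N + 1 : ℕ) : ℝ) + 1 + i)
    have hne : (N : ℝ) + 1 + k ≠ 0 := by positivity
    have e3 : Q * (((N + 1 : ℕ) : ℝ) * ((((N + 1 : ℕ) : ℝ) + k) ^ (k + 1))⁻¹) =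
        P * (((N : ℝ) + k + 1) ^ k)⁻¹ := by
      have e4 : (N : ℝ) + k + 1 = N + 1 + k := by ring
      rw [e4]
      push_cast
      rw [← mul_assoc, ← key, pow_succ]
      field_simp
    rw [mul_sub, e3]
    ring

lemma hasSum_lam (d : ℕ) (hd : 0 < d) :
    HasSum (fun n : ℕ => (((n + (d - 1)).choose (d - 1) : ℕ) : ℝ) * lam d n) 1 := by
  rw [hasSum_iff_tendsto_nat_of_nonneg (fun n => mul_nonneg (by positivity) (lam_nonneg d hd n))]
  rw [← Filter.tendsto_add_atTop_iff_nat 1]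
  obtain ⟨k, rfl⟩ : ∃ k, d = k + 1 := ⟨d - 1, by omega⟩
  simp only [Nat.add_sub_cancel, partial_sum]
  have h : ∀ i ∈ Finset.range k, Filter.Tendsto (fun N : ℕ => ((N : ℝ) + 1 + i) / (N + k + 1))
      Filter.atTop (nhds 1) := by
    intro i _
    have h1 : (fun N : ℕ => ((N : ℝ) + 1 + i) / (N + k + 1)) =
        fun N : ℕ => 1 + ((i : ℝ) - k) / ((N : ℝ) + (k + 1)) := by
      funext N
      have : (N : ℝ) + k + 1 ≠ 0 := by positivity
      have h' : (N : ℝ) + (k + 1) ≠ 0 := by positivity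
      field_simp
      ring
    rw [h1]
    have h2 : Filter.Tendsto (fun N : ℕ => ((i : ℝ) - k) / ((N : ℝ) + (k + 1)))
        Filter.atTop (nhds 0) :=
      Filter.Tendsto.const_div_atTop
        (Filter.tendsto_atTop_add_const_right _ _ tendsto_natCast_atTop_atTop) _
    simpa using h2.const_add 1
  simpa using tendsto_finset_prod _ h

lemma tsum_lam (d : ℕ) (hd : 0 < d) :
    ∑' α : Fin d → ℕ, ENNReal.ofReal (lam d (∑ j, α j)) = 1 := by
  rw [← ENNReal.tsum_fiberwise _ (fun α : Fin d → ℕ => ∑ j, α j)]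
  have h1 : ∀ n : ℕ, ∑' α : (fun α : Fin d → ℕ => ∑ j, α j) ⁻¹' {n},
      ENNReal.ofReal (lam d (∑ j, α.1 j)) =
      ENNReal.ofReal ((((n + (d - 1)).choose (d - 1) : ℕ) : ℝ) * lam d n) := by
    intro n
    have e : ∀ α : (fun α : Fin d → ℕ => ∑ j, α j) ⁻¹' {n},
        ENNReal.ofReal (lam d (∑ j, α.1 j)) = ENNReal.ofReal (lam d n) := by
      rintro ⟨α, hα⟩
      have : ∑ j, α j = n := hα
      simp only [this]
    simp only [e]
    have eqv : Sym (Fin d) n ≃ (fun α : Fin d → ℕ => ∑ j, α j) ⁻¹' {n} :=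
      Sym.equivNatSumOfFintype (Fin d) n
    rw [← eqv.tsum_eq, tsum_fintype, Finset.sum_const, Finset.card_univ,
      Sym.card_sym_eq_choose, nsmul_eq_mul, ENNReal.ofReal_mul (by positivity),
      ENNReal.ofReal_natCast, Fintype.card_fin]
    have : d + n - 1 = n + (d - 1) := by omega
    rw [this, Nat.choose_symm_add]
  simp only [h1]
  rw [← ENNReal.ofReal_tsum_of_nonneg (fun n => mul_nonneg (by positivity) (lam_nonneg d hd n))
    (hasSum_lam d hd).summable, (hasSum_lam d hd).tsum_eq]
  simp

end trace

section diag
variable {ι : Type*} (b : HilbertBasis ι ℂ H) (T : H →L[ℂ] H) (r : ι → ℝ)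

lemma diag_inner (hT : ∀ α, T (b α) = (r α : ℂ) • b α)
    (α : ι) (x : H) : inner ℂ (b α) (T x) = (r α : ℂ) * inner ℂ (b α) x := by
  classical
  have hb := b.orthonormal
  rw [orthonormal_iff_ite] at hb
  have h : adjoint T (b α) = (r α : ℂ) • b α := by
    apply b.repr.injective
    ext γ
    rw [b.repr_apply_apply, b.repr_apply_apply, ContinuousLinearMap.adjoint_inner_right, hT,
      inner_smul_left, inner_smul_right, hb]
    by_cases hh : γ = α
    · subst hh; simp
    · simp [hh]
  rw [← ContinuousLinearMap.adjoint_inner_left, h, inner_smul_left]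
  simp

lemma diag_hasSum (hT : ∀ α, T (b α) = (r α : ℂ) • b α)
    (x y : H) :
    HasSum (fun α => (r α : ℂ) * (inner ℂ y (b α) * inner ℂ (b α) x)) (inner ℂ y (T x)) := by
  have := b.hasSum_inner_mul_inner y (T x)
  simp only [diag_inner b T r hT] at this
  have e : (fun α => (r α : ℂ) * (inner ℂ y (b α) * inner ℂ (b α) x)) =
      fun α => inner ℂ y (b α) * ((r α : ℂ) * inner ℂ (b α) x) := by
    funext α
    ring
  rw [e]
  exact this

lemma diag_pos (hT : ∀ α, T (b α) = (r α : ℂ) • b α)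
    (hr : ∀ α, 0 ≤ r α) : T.IsPositive := by
  rw [ContinuousLinearMap.isPositive_iff_complex]
  intro x
  have h := diag_hasSum b T r hT x x
  have h1 : (fun α => (r α : ℂ) * (inner ℂ x (b α) * inner ℂ (b α) x)) =
      fun α => ((r α * ‖inner ℂ (b α) x‖ ^ 2 : ℝ) : ℂ) := by
    funext α
    rw [← inner_conj_symm x (b α), mul_comm (starRingEnd ℂ _), Complex.mul_conj']
    push_cast
    rfl
  rw [h1] at h
  have h2 : 0 ≤ (inner ℂ x (T x) : ℂ) := by
    refine h.nonneg fun α => ?_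
    rw [Complex.zero_le_real]
    exact mul_nonneg (hr α) (by positivity)
  have h3 : inner ℂ (T x) x = (starRingEnd ℂ) (inner ℂ x (T x)) := (inner_conj_symm _ _).symm
  rw [h3]
  generalize (inner ℂ x (T x) : ℂ) = z at h2
  rw [Complex.nonneg_iff] at h2
  constructor
  · apply Complex.ext <;> simp [← h2.2]
  · simpa using h2.1

lemma diag_trace (hT : ∀ α, T (b α) = (r α : ℂ) • b α)
    (hr : ∀ α, 0 ≤ r α) :
    traceNorm T = ∑' α, ENNReal.ofReal (r α) := by
  classical
  apply le_antisymm
  · unfold traceNorm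
    refine iSup_le fun n => iSup_le fun f => iSup_le fun g => iSup_le fun hf => iSup_le fun hg => ?_
    have h1 : ∀ i, (‖inner ℂ (T (f i)) (g i)‖₊ : ℝ≥0∞) ≤
        ∑' α, ENNReal.ofReal (r α) *
          ENNReal.ofReal (‖inner ℂ (g i) (b α)‖ * ‖inner ℂ (f i) (b α)‖) := by
      intro i
      have h := (diag_hasSum b T r hT (f i) (g i)).tsum_eq
      have e0 : (‖inner ℂ (T (f i)) (g i)‖₊ : ℝ≥0∞) = ‖inner ℂ (g i) (T (f i))‖ₑ := by
        rw [← enorm_eq_nnnorm, ← ofReal_norm, ← ofReal_norm, norm_inner_symm]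
      rw [e0, ← h]
      refine enorm_tsum_le_tsum_enorm.trans (le_of_eq ?_)
      refine tsum_congr fun α => ?_
      rw [← ENNReal.ofReal_mul (hr α), ← ofReal_norm, norm_mul, norm_mul,
        norm_inner_symm (b α) (f i), Complex.norm_real, Real.norm_of_nonneg (hr α)]
    calc ∑ i, (‖inner ℂ (T (f i)) (g i)‖₊ : ℝ≥0∞)
        ≤ ∑ i, ∑' α, ENNReal.ofReal (r α) *
          ENNReal.ofReal (‖inner ℂ (g i) (b α)‖ * ‖inner ℂ (f i) (b α)‖) :=
          Finset.sum_le_sum fun i _ => h1 i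
      _ = ∑' α, ∑ i, ENNReal.ofReal (r α) *
          ENNReal.ofReal (‖inner ℂ (g i) (b α)‖ * ‖inner ℂ (f i) (b α)‖) :=
          (Summable.tsum_finsetSum fun i _ => ENNReal.summable).symm
      _ ≤ ∑' α, ENNReal.ofReal (r α) := by
          refine ENNReal.tsum_le_tsum fun α => ?_
          rw [← Finset.mul_sum, ← ENNReal.ofReal_sum_of_nonneg (fun i _ => by positivity)]
          have hfb := hf.sum_inner_products_le (b α) (s := Finset.univ)
          have hgb := hg.sum_inner_products_le (b α) (s := Finset.univ)
          rw [b.orthonormal.1 α] at hfb hgb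
          have : ∑ i, ‖inner ℂ (g i) (b α)‖ * ‖inner ℂ (f i) (b α)‖ ≤ 1 := by
            have h2 : ∑ i, ‖inner ℂ (g i) (b α)‖ * ‖inner ℂ (f i) (b α)‖ ≤
                ∑ i, (‖inner ℂ (g i) (b α)‖ ^ 2 / 2 + ‖inner ℂ (f i) (b α)‖ ^ 2 / 2) := by
              refine Finset.sum_le_sum fun i _ => ?_
              nlinarith [sq_nonneg (‖inner ℂ (g i) (b α)‖ - ‖inner ℂ (f i) (b α)‖)]
            rw [Finset.sum_add_distrib, ← Finset.sum_div, ← Finset.sum_div] at h2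
            linarith
          calc _ ≤ ENNReal.ofReal (r α) * 1 := by
                gcongr
                exact ENNReal.ofReal_le_one.mpr this
            _ = _ := mul_one _
  · rw [ENNReal.tsum_eq_iSup_sum]
    refine iSup_le fun s => ?_
    unfold traceNorm
    set f : Fin s.card → H := fun i => b (s.equivFin.symm i) with hf
    have hfo : Orthonormal ℂ f :=
      b.orthonormal.comp _ (Subtype.val_injective.comp s.equivFin.symm.injective)
    refine le_trans (le_of_eq ?_) (le_iSup_of_le s.card (le_iSup_of_le f (le_iSup_of_le f
      (le_iSup_of_le hfo (le_iSup_of_le hfo le_rfl)))))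
    have e : ∀ i, (‖inner ℂ (T (f i)) (f i)‖₊ : ℝ≥0∞) =
        ENNReal.ofReal (r (s.equivFin.symm i)) := by
      intro i
      simp only [hf, hT, inner_smul_left]
      rw [← enorm_eq_nnnorm, ← ofReal_norm]
      simp [b.orthonormal.1, inner_self_eq_norm_sq_to_K, abs_of_nonneg (hr _)]
    simp only [e]
    rw [Equiv.sum_comp s.equivFin.symm (fun a : s => ENNReal.ofReal (r a))]
    exact (Finset.sum_coe_sort s (fun a => ENNReal.ofReal (r a))).symm

end diag

/-- for the `d`-tuple of coordinate multiplications on the Hardy space of the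
Euclidean ball (the joint weighted shift `S i e_α = √((α i + 1)/(|α| + d)) e_{α+εᵢ}`), the
determinant operator is diagonal with the stated eigenvalues, non-negative definite, and of
trace `1`. -/
theorem statement_19 {d : ℕ} (hd : 0 < d)
    (b : HilbertBasis (Fin d → ℕ) ℂ H) (S : Fin d → H →L[ℂ] H)
    (hS : ∀ (i : Fin d) (α : Fin d → ℕ),
      S i (b α) = (Real.sqrt (((α i : ℝ) + 1) / ((∑ j, (α j : ℝ)) + d)) : ℂ) •
        b (α + Pi.single i 1)) :
    (∀ α : Fin d → ℕ, detOp S (b α) =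
      ((((d - 1).factorial : ℝ) *
        ((((∑ j, (α j : ℝ)) + d) ^ (d - 1))⁻¹ -
          (∑ j, (α j : ℝ)) * (((∑ j, (α j : ℝ)) + d - 1) ^ d)⁻¹) : ℝ) : ℂ) • b α) ∧
    (detOp S).IsPositive ∧ traceNorm (detOp S) = 1 := by
  have h1 := detOp_basis b S hS hd
  have hl : ∀ α : Fin d → ℕ, detOp S (b α) = ((lam d (∑ j, α j) : ℝ) : ℂ) • b α := by
    intro α
    rw [h1, lam]
    push_cast
    rfl
  refine ⟨h1, diag_pos b _ _ hl fun α => lam_nonneg d hd _, ?_⟩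
  rw [diag_trace b _ _ hl fun α => lam_nonneg d hd _, tsum_lam d hd]
end
end
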